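/- arXiv:1811.05075 — 3 statements merged into one kernel-verified Lean document; each statement's English description precedes it below -/
import Mathlib

section
/- Suppose β1'(1) ≤ α ≤ β1'(0) and β2'(+∞) ≤ α' < β2'(1), and suppose it is NOT the case that there exists s1 ∈ [0,1] with β2^*(α') = s1·α' − β1(s1) and β1'(s1) ≤ α < β1'(0). Then dim_H E(μ,α,α') = min{ β1^*(α), β2^*(α') }. -/
open MeasureTheory Filter Set Metric Topology

/-- `moranCyl c w n (x, ℓ)` refines the interval `[x, x + ℓ]` along the binary word `w`,
using the contraction ratio `c k` at step `k` (the first letter of `w` is processed with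
index `n`).  The result `(x', ℓ')` describes the interval `[x', x' + ℓ']`. -/
noncomputable def moranCyl (c : ℕ → ℝ) : List Bool → ℕ → ℝ × ℝ → ℝ × ℝ
  | [], _, st => st
  | bb :: w, n, st =>
      moranCyl c w (n + 1)
        (if bb then (st.1 + st.2 - st.2 / c n, st.2 / c n) else (st.1, st.2 / c n))

/-- The basic interval `I_w` of the Moran construction with ratios `c`. -/
noncomputable def moranI (c : ℕ → ℝ) (w : List Bool) : Set ℝ :=
  Icc (moranCyl c w 1 (0, 1)).1 ((moranCyl c w 1 (0, 1)).1 + (moranCyl c w 1 (0, 1)).2)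

/-- The length `|I_w|` of the basic interval `I_w`. -/
noncomputable def moranLen (c : ℕ → ℝ) (w : List Bool) : ℝ :=
  (moranCyl c w 1 (0, 1)).2

/-- The Moran set `⋂ n ⋃ {I_w : |w| = n}`. -/
noncomputable def moranSet (c : ℕ → ℝ) : Set ℝ :=
  ⋂ n : ℕ, ⋃ w ∈ {w : List Bool | w.length = n}, moranI c w

/-- The mass assigned to the cylinder `I_w` by the Moran measure with weight `r k` for the
letter at step `k`: `cylMass r w 1 1 = μ(I_w)`. -/
noncomputable def cylMass (r : ℕ → ℝ) : List Bool → ℕ → ℝ → ℝ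
  | [], _, m => m
  | bb :: w, n, m => cylMass r w (n + 1) (if bb then (1 - r n) * m else r n * m)

/-- Lower local dimension `liminf_{r → 0⁺} log μ(B(x,r)) / log r`. -/
noncomputable def lowerLocalDim (μ : Measure ℝ) (x : ℝ) : ℝ :=
  liminf (fun rr : ℝ => Real.log (μ (closedBall x rr)).toReal / Real.log rr) (𝓝[>] 0)

/-- Upper local dimension `limsup_{r → 0⁺} log μ(B(x,r)) / log r`. -/
noncomputable def upperLocalDim (μ : Measure ℝ) (x : ℝ) : ℝ :=
  limsup (fun rr : ℝ => Real.log (μ (closedBall x rr)).toReal / Real.log rr) (𝓝[>] 0)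

/-- `betaFn ρ C s = -log (ρ^s + (1-ρ)^s) / log C`; so `β₁ = betaFn p A`, `β₂ = betaFn q B`. -/
noncomputable def betaFn (ρ C : ℝ) (s : ℝ) : ℝ :=
  -Real.log (ρ ^ s + (1 - ρ) ^ s) / Real.log C

/-- The Legendre transform `f^*(α) = inf_s (s α - f(s))`. -/
noncomputable def legendre (f : ℝ → ℝ) (α : ℝ) : ℝ :=
  ⨅ s : ℝ, (s * α - f s)

/-- The modification `β̃₁` of `β₁`, linear on `(0,1)`. -/
noncomputable def betaTilde1 (ρ C : ℝ) (s : ℝ) : ℝ :=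
  if s ≤ 0 ∨ 1 ≤ s then betaFn ρ C s
  else (1 - s) * betaFn ρ C 0 + s * betaFn ρ C 1

/-- `packSup μ X r s` is the supremum of `∑ᵢ μ(B(xᵢ,r))^s` over all finite families of
pairwise disjoint closed balls of radius `r` with centers in `X`. -/
noncomputable def packSup (μ : Measure ℝ) (X : Set ℝ) (rr s : ℝ) : ℝ :=
  sSup {y : ℝ | ∃ t : Finset ℝ, (↑t : Set ℝ) ⊆ X ∧
    (↑t : Set ℝ).Pairwise (fun u v => Disjoint (closedBall u rr) (closedBall v rr)) ∧
    y = ∑ u ∈ t, (μ (closedBall u rr)).toReal ^ s}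

namespace Moran

/-- `-log` of the length of the basic intervals of level `n`. -/
noncomputable def logLen (c : ℕ → ℝ) (n : ℕ) : ℝ :=
  ∑ k ∈ Finset.range n, Real.log (c (k + 1))

/-- The length of the basic intervals of level `n`. -/
noncomputable def len (c : ℕ → ℝ) (n : ℕ) : ℝ := Real.exp (-logLen c n)

/-- The left endpoint of the basic interval of level `n` coded by `ω`. -/
noncomputable def pos (c : ℕ → ℝ) (n : ℕ) (ω : ℕ → Bool) : ℝ :=
  ∑ k ∈ Finset.range n, if ω k then len c k - len c (k + 1) else 0

/-- The basic interval of level `n` coded by `ω`. -/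
noncomputable def cyl (c : ℕ → ℝ) (n : ℕ) (ω : ℕ → Bool) : Set ℝ :=
  Icc (pos c n ω) (pos c n ω + len c n)

/-- `-log` of the weight of the letter `b` at position `k`. -/
noncomputable def cost (r : ℕ → ℝ) (k : ℕ) (b : Bool) : ℝ :=
  -Real.log (if b then 1 - r (k + 1) else r (k + 1))

/-- `-log` of the mass of the basic interval of level `n` coded by `ω`. -/
noncomputable def logMass (r : ℕ → ℝ) (n : ℕ) (ω : ℕ → Bool) : ℝ :=
  ∑ k ∈ Finset.range n, cost r k (ω k)

/-- Uniform bounds on the ratios and the weights of a Moran construction. -/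
structure Bounds (c r : ℕ → ℝ) (A B K : ℝ) : Prop where
  two_lt : 2 < B
  le_ratio : ∀ k, B ≤ c (k + 1)
  ratio_le : ∀ k, c (k + 1) ≤ A
  weight_pos : ∀ k, 0 < r (k + 1)
  weight_lt_one : ∀ k, r (k + 1) < 1
  cost_le : ∀ k b, cost r k b ≤ K

variable {c r : ℕ → ℝ} {A B K : ℝ}

lemma logLen_succ (c : ℕ → ℝ) (n : ℕ) :
    logLen c (n + 1) = logLen c n + Real.log (c (n + 1)) :=
  Finset.sum_range_succ _ _

lemma len_pos (c : ℕ → ℝ) (n : ℕ) : 0 < len c n := Real.exp_pos _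

lemma len_zero (c : ℕ → ℝ) : len c 0 = 1 := by simp [len, logLen]

lemma Bounds.ratio_pos (h : Bounds c r A B K) (k : ℕ) : 0 < c (k + 1) := by
  linarith [h.two_lt, h.le_ratio k]

lemma Bounds.len_succ (h : Bounds c r A B K) (n : ℕ) :
    len c (n + 1) = len c n / c (n + 1) := by
  rw [len, logLen_succ, neg_add, Real.exp_add, Real.exp_neg (Real.log _),
    Real.exp_log (h.ratio_pos n), len, div_eq_mul_inv]

lemma pos_succ (c : ℕ → ℝ) (n : ℕ) (ω : ℕ → Bool) :
    pos c (n + 1) ω = pos c n ω + if ω n then len c n - len c (n + 1) else 0 :=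
  Finset.sum_range_succ _ _

lemma logMass_succ (r : ℕ → ℝ) (n : ℕ) (ω : ℕ → Bool) :
    logMass r (n + 1) ω = logMass r n ω + cost r n (ω n) :=
  Finset.sum_range_succ _ _

lemma pos_congr (c : ℕ → ℝ) {n : ℕ} {ω ω' : ℕ → Bool} (h : ∀ k < n, ω k = ω' k) :
    pos c n ω = pos c n ω' :=
  Finset.sum_congr rfl fun k hk => by rw [h k (Finset.mem_range.1 hk)]

lemma cyl_congr (c : ℕ → ℝ) {n : ℕ} {ω ω' : ℕ → Bool} (h : ∀ k < n, ω k = ω' k) :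
    cyl c n ω = cyl c n ω' := by
  rw [cyl, cyl, pos_congr c h]

lemma moranCyl_append (c : ℕ → ℝ) (w : List Bool) (b : Bool) (n : ℕ) (st : ℝ × ℝ) :
    moranCyl c (w ++ [b]) n st =
      if b then ((moranCyl c w n st).1 + (moranCyl c w n st).2 -
          (moranCyl c w n st).2 / c (n + w.length), (moranCyl c w n st).2 / c (n + w.length))
      else ((moranCyl c w n st).1, (moranCyl c w n st).2 / c (n + w.length)) := by
  induction w generalizing n st with
  | nil => simp [moranCyl]
  | cons a w ih =>
    simp only [List.cons_append, moranCyl, ih, List.length_cons]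
    rw [show n + 1 + w.length = n + (w.length + 1) by ring]

lemma cylMass_append (r : ℕ → ℝ) (w : List Bool) (b : Bool) (n : ℕ) (m : ℝ) :
    cylMass r (w ++ [b]) n m =
      (if b then 1 - r (n + w.length) else r (n + w.length)) * cylMass r w n m := by
  induction w generalizing n m with
  | nil => cases b <;> simp [cylMass]
  | cons a w ih =>
    simp only [List.cons_append, cylMass, ih, List.length_cons]
    rw [show n + 1 + w.length = n + (w.length + 1) by ring]

/-- The word formed by the first `n` letters of `ω`. -/
def word (n : ℕ) (ω : ℕ → Bool) : List Bool := (List.range n).map ω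

lemma length_word (n : ℕ) (ω : ℕ → Bool) : (word n ω).length = n := by simp [word]

lemma word_succ (n : ℕ) (ω : ℕ → Bool) : word (n + 1) ω = word n ω ++ [ω n] := by
  simp [word, List.range_succ]

lemma exists_word (w : List Bool) : ∃ ω, w = word w.length ω := by
  refine ⟨fun k => w.getD k false, List.ext_getElem (by simp [word]) fun i h₁ h₂ => ?_⟩
  simp [word, h₁]

lemma Bounds.moranCyl_word (h : Bounds c r A B K) (n : ℕ) (ω : ℕ → Bool) :
    moranCyl c (word n ω) 1 (0, 1) = (pos c n ω, len c n) := by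
  induction n with
  | zero => simp [word, moranCyl, pos, len_zero]
  | succ n ih =>
    rw [word_succ, moranCyl_append, ih, length_word, pos_succ, h.len_succ, add_comm 1 n]
    cases ω n <;> simp
    ring

lemma Bounds.moranI_word (h : Bounds c r A B K) (n : ℕ) (ω : ℕ → Bool) :
    moranI c (word n ω) = cyl c n ω := by
  rw [moranI, h.moranCyl_word]; rfl

lemma Bounds.exp_neg_cost (h : Bounds c r A B K) (k : ℕ) (b : Bool) :
    Real.exp (-cost r k b) = if b then 1 - r (k + 1) else r (k + 1) := by
  rw [cost, neg_neg, Real.exp_log]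
  have := h.weight_pos k
  have := h.weight_lt_one k
  split_ifs <;> linarith

lemma Bounds.cost_nonneg (h : Bounds c r A B K) (k : ℕ) (b : Bool) : 0 ≤ cost r k b := by
  rw [cost]
  have := h.weight_pos k
  have := h.weight_lt_one k
  refine neg_nonneg.2 (Real.log_nonpos ?_ ?_) <;> split_ifs <;> linarith

lemma Bounds.cylMass_word (h : Bounds c r A B K) (n : ℕ) (ω : ℕ → Bool) :
    cylMass r (word n ω) 1 1 = Real.exp (-logMass r n ω) := by
  induction n with
  | zero => simp [word, cylMass, logMass]
  | succ n ih =>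
    rw [word_succ, cylMass_append, ih, length_word, logMass_succ, neg_add, Real.exp_add,
      h.exp_neg_cost, add_comm 1 n, mul_comm]

lemma Bounds.mem_moranSet (h : Bounds c r A B K) (x : ℝ) :
    x ∈ moranSet c ↔ ∀ n, ∃ ω, x ∈ cyl c n ω := by
  simp only [moranSet, mem_iInter, mem_iUnion, mem_ofPred_eq, exists_prop]
  refine forall_congr' fun n => ⟨?_, ?_⟩
  · rintro ⟨w, rfl, hx⟩
    obtain ⟨ω, hω⟩ := exists_word w
    rw [hω, h.moranI_word] at hx
    exact ⟨ω, hx⟩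
  · rintro ⟨ω, hx⟩
    exact ⟨word n ω, length_word n ω, by rwa [h.moranI_word]⟩

lemma Bounds.log_pos (h : Bounds c r A B K) : 0 < Real.log B :=
  Real.log_pos (by linarith [h.two_lt])

lemma Bounds.log_le (h : Bounds c r A B K) (k : ℕ) : Real.log B ≤ Real.log (c (k + 1)) :=
  Real.log_le_log (by linarith [h.two_lt]) (h.le_ratio k)

lemma Bounds.le_log (h : Bounds c r A B K) (k : ℕ) : Real.log (c (k + 1)) ≤ Real.log A :=
  Real.log_le_log (h.ratio_pos k) (h.ratio_le k)

lemma Bounds.logLen_mono (h : Bounds c r A B K) : Monotone (logLen c) :=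
  monotone_nat_of_le_succ fun n => by
    rw [logLen_succ]; linarith [h.log_le n, h.log_pos]

lemma Bounds.len_anti (h : Bounds c r A B K) : Antitone (len c) := fun _ _ hmn =>
  Real.exp_le_exp.2 (neg_le_neg (h.logLen_mono hmn))

lemma Bounds.mul_log_le (h : Bounds c r A B K) (n : ℕ) : n * Real.log B ≤ logLen c n := by
  have := Finset.card_nsmul_le_sum (Finset.range n) (fun k => Real.log (c (k + 1)))
    (Real.log B) fun k _ => h.log_le k
  simpa [logLen] using this

lemma Bounds.logMass_nonneg (h : Bounds c r A B K) (n : ℕ) (ω : ℕ → Bool) :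
    0 ≤ logMass r n ω :=
  Finset.sum_nonneg fun k _ => h.cost_nonneg k (ω k)

lemma Bounds.logMass_add_le (h : Bounds c r A B K) (n m : ℕ) (ω : ℕ → Bool) :
    logMass r (n + m) ω ≤ logMass r n ω + m * K := by
  induction m with
  | zero => simp
  | succ m ih =>
    rw [← add_assoc, logMass_succ]
    push_cast
    linarith [h.cost_le (n + m) (ω (n + m))]

lemma Bounds.logMass_le (h : Bounds c r A B K) (n : ℕ) (ω : ℕ → Bool) :
    logMass r n ω ≤ n * K := by
  simpa [logMass] using h.logMass_add_le 0 n ω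

lemma Bounds.bound_nonneg (h : Bounds c r A B K) : 0 ≤ K :=
  (h.cost_nonneg 0 true).trans (h.cost_le 0 true)

lemma Bounds.cyl_succ_subset (h : Bounds c r A B K) (n : ℕ) (ω : ℕ → Bool) :
    cyl c (n + 1) ω ⊆ cyl c n ω := by
  intro x hx
  simp only [cyl, mem_Icc, pos_succ] at hx ⊢
  have h₁ := h.len_anti (Nat.le_succ n)
  have h₂ := len_pos c (n + 1)
  simp only [Nat.succ_eq_add_one] at h₁
  cases hω : ω n <;> simp only [hω, if_true, Bool.false_eq_true, if_false] at hx <;>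
    constructor <;> linarith [hx.1, hx.2]

lemma Bounds.cyl_anti (h : Bounds c r A B K) (ω : ℕ → Bool) : Antitone fun n => cyl c n ω :=
  antitone_nat_of_succ_le fun n => h.cyl_succ_subset n ω

lemma Bounds.gap_le (h : Bounds c r A B K) (k : ℕ) :
    (1 - 2 / B) * len c k ≤ len c k - 2 * len c (k + 1) := by
  have hB : 0 < B := by linarith [h.two_lt]
  have : len c (k + 1) ≤ len c k / B := by
    rw [h.len_succ]
    exact div_le_div_of_nonneg_left (len_pos c k).le hB (h.le_ratio k)
  have h2 : (1 - 2 / B) * len c k = len c k - 2 * (len c k / B) := by ring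
  linarith

lemma Bounds.gap_pos (h : Bounds c r A B K) : 0 < 1 - 2 / B := by
  have hB : 0 < B := by linarith [h.two_lt]
  rw [sub_pos, div_lt_one hB]; exact h.two_lt

lemma Bounds.gap_le_dist (h : Bounds c r A B K) {k n : ℕ} (hk : k < n) {ω ω' : ℕ → Bool}
    (hpre : ∀ j < k, ω j = ω' j) (hne : ω k ≠ ω' k) {x y : ℝ}
    (hx : x ∈ cyl c n ω) (hy : y ∈ cyl c n ω') :
    (1 - 2 / B) * len c k ≤ |x - y| := by
  wlog hb : ω k = false generalizing ω ω' x y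
  · rw [abs_sub_comm]
    refine this (fun j hj => (hpre j hj).symm) hne.symm hy hx ?_
    cases h' : ω' k <;> simp_all
  have hb' : ω' k = true := by cases h' : ω' k <;> simp_all
  have hx := h.cyl_anti ω hk hx
  have hy := h.cyl_anti ω' hk hy
  simp only [cyl, mem_Icc, Nat.succ_eq_add_one, pos_succ, hb, hb', pos_congr c hpre] at hx hy
  simp only [if_true, Bool.false_eq_true, if_false] at hx hy
  rw [abs_sub_comm]
  refine le_trans ?_ (le_abs_self _)
  linarith [h.gap_le k, hx.2, hy.1]

lemma Bounds.eq_of_dist_lt (h : Bounds c r A B K) {n : ℕ} {ω ω' : ℕ → Bool} {x y : ℝ}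
    (hx : x ∈ cyl c n ω) (hy : y ∈ cyl c n ω') (hxy : |x - y| < (1 - 2 / B) * len c n) :
    ∀ k < n, ω k = ω' k := by
  intro k
  induction k using Nat.strong_induction_on with
  | _ k ih =>
    intro hk
    by_contra hne
    have h₁ := h.gap_le_dist hk (fun j hj => ih j hj (hj.trans hk)) hne hx hy
    have h₂ := mul_le_mul_of_nonneg_left (h.len_anti hk.le) h.gap_pos.le
    linarith

lemma Bounds.eq_of_mem (h : Bounds c r A B K) {n : ℕ} {ω ω' : ℕ → Bool} {x : ℝ}
    (hx : x ∈ cyl c n ω) (hx' : x ∈ cyl c n ω') : ∀ k < n, ω k = ω' k :=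
  h.eq_of_dist_lt hx hx' (by simpa using mul_pos h.gap_pos (len_pos c n))

lemma Bounds.exists_code (h : Bounds c r A B K) {x : ℝ} (hx : x ∈ moranSet c) :
    ∃ ω, ∀ n, x ∈ cyl c n ω := by
  choose v hv using (h.mem_moranSet x).1 hx
  refine ⟨fun k => v (k + 1) k, fun n => ?_⟩
  rw [cyl_congr c (ω' := v n)]
  · exact hv n
  · intro k hk
    exact h.eq_of_mem (hv (k + 1)) (h.cyl_anti (v n) hk (hv n)) k (Nat.lt_succ_self k)

/-- Extension of a finite word by `false`. -/
def extend {n : ℕ} (v : Fin n → Bool) (k : ℕ) : Bool := if h : k < n then v ⟨k, h⟩ else false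

lemma extend_restrict (n : ℕ) (ω : ℕ → Bool) :
    ∀ k < n, extend (fun i : Fin n => ω i) k = ω k := by
  intro k hk; simp [extend, hk]

lemma sum_prod_extend (n : ℕ) (f : ℕ → Bool → ℝ) :
    ∑ v : Fin n → Bool, ∏ k ∈ Finset.range n, f k (extend v k) =
      ∏ k ∈ Finset.range n, (f k true + f k false) := by
  have h₁ := Finset.prod_univ_sum (fun _ : Fin n => (Finset.univ : Finset Bool))
    (fun i b => f i b)
  simp only [Fintype.piFinset_univ] at h₁
  rw [Finset.prod_range]
  simp only [Fintype.sum_bool] at h₁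
  rw [h₁]
  refine Finset.sum_congr rfl fun v _ => ?_
  rw [Finset.prod_range]
  exact Finset.prod_congr rfl fun i _ => by simp [extend]

lemma Bounds.sum_exp_neg_logMass (h : Bounds c r A B K) (n : ℕ) :
    ∑ v : Fin n → Bool, Real.exp (-logMass r n (extend v)) = 1 := by
  simp_rw [logMass, ← Finset.sum_neg_distrib, Real.exp_sum]
  rw [sum_prod_extend n fun k b => Real.exp (-cost r k b)]
  refine Finset.prod_eq_one fun k _ => ?_
  simp [h.exp_neg_cost]

end Moran

namespace Moran

variable {c r : ℕ → ℝ} {A B K : ℝ}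

/-- `μ` gives the basic intervals the masses prescribed by `r`. -/
def HasCylMass (μ : Measure ℝ) (c r : ℕ → ℝ) : Prop :=
  ∀ w : List Bool, μ (moranI c w) = ENNReal.ofReal (cylMass r w 1 1)

lemma Bounds.measure_cyl {μ : Measure ℝ} (h : Bounds c r A B K)
    (hμ : HasCylMass μ c r) (n : ℕ) (ω : ℕ → Bool) :
    μ (cyl c n ω) = ENNReal.ofReal (Real.exp (-logMass r n ω)) := by
  rw [← h.moranI_word, hμ, h.cylMass_word]

variable {μ : Measure ℝ} [IsProbabilityMeasure μ]

lemma Bounds.measure_compl_iUnion (h : Bounds c r A B K) (hμ : HasCylMass μ c r) (n : ℕ) :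
    μ (⋃ v : Fin n → Bool, cyl c n (extend v))ᶜ = 0 := by
  have hmeas : ∀ v : Fin n → Bool, MeasurableSet (cyl c n (extend v)) := fun v =>
    measurableSet_Icc
  rw [prob_compl_eq_zero_iff (MeasurableSet.iUnion hmeas), measure_iUnion _ hmeas, tsum_fintype]
  · simp_rw [h.measure_cyl hμ]
    rw [← ENNReal.ofReal_sum_of_nonneg fun v _ => (Real.exp_pos _).le, h.sum_exp_neg_logMass,
      ENNReal.ofReal_one]
  · intro v v' hne
    refine Set.disjoint_left.2 fun x hx hx' => hne (funext fun i => ?_)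
    simpa [extend] using h.eq_of_mem hx hx' i i.2

/-- `-log` of the mass of a ball. -/
noncomputable def logBall (μ : Measure ℝ) (x ρ : ℝ) : ℝ :=
  -Real.log (μ (closedBall x ρ)).toReal

lemma Bounds.logBall_le (h : Bounds c r A B K) (hμ : HasCylMass μ c r) {n : ℕ}
    {ω : ℕ → Bool} {x ρ : ℝ} (hx : x ∈ cyl c n ω) (hρ : len c n ≤ ρ) :
    logBall μ x ρ ≤ logMass r n ω := by
  have hsub : cyl c n ω ⊆ closedBall x ρ := fun y hy => by
    rw [mem_closedBall, Real.dist_eq, abs_le]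
    simp only [cyl, mem_Icc] at hx hy
    constructor <;> linarith [hx.1, hx.2, hy.1, hy.2]
  have h₁ : Real.exp (-logMass r n ω) ≤ (μ (closedBall x ρ)).toReal := by
    have := ENNReal.toReal_mono (measure_ne_top μ _) (measure_mono (μ := μ) hsub)
    rwa [h.measure_cyl hμ, ENNReal.toReal_ofReal (Real.exp_pos _).le] at this
  have := Real.log_le_log (Real.exp_pos _) h₁
  rw [Real.log_exp] at this
  rw [logBall]; linarith

lemma Bounds.le_logBall (h : Bounds c r A B K) (hμ : HasCylMass μ c r) {ω : ℕ → Bool} {x ρ : ℝ}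
    (hx : ∀ n, x ∈ cyl c n ω) (hρ0 : 0 < ρ) {n : ℕ} (hρ : ρ < (1 - 2 / B) * len c n) :
    logMass r n ω ≤ logBall μ x ρ := by
  have hsub : closedBall x ρ ⊆ cyl c n ω ∪ (⋃ v : Fin n → Bool, cyl c n (extend v))ᶜ := by
    intro y hy
    by_cases hyU : y ∈ ⋃ v : Fin n → Bool, cyl c n (extend v)
    · left
      obtain ⟨v, hv⟩ := mem_iUnion.1 hyU
      rw [mem_closedBall, Real.dist_eq] at hy
      rwa [← cyl_congr c (h.eq_of_dist_lt hv (hx n) (hy.trans_lt hρ))]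
    · exact Or.inr hyU
  have h₁ : (μ (closedBall x ρ)).toReal ≤ Real.exp (-logMass r n ω) := by
    refine ENNReal.toReal_le_of_le_ofReal (Real.exp_pos _).le ?_
    rw [← h.measure_cyl hμ]
    refine (measure_mono hsub).trans ((measure_union_le _ _).trans ?_)
    rw [h.measure_compl_iUnion hμ, add_zero]
  have hpos : 0 < (μ (closedBall x ρ)).toReal := by
    obtain ⟨m, hm⟩ : ∃ m, len c m ≤ ρ := by
      obtain ⟨m, hm⟩ := exists_nat_gt (-Real.log ρ / Real.log B)
      refine ⟨m, ?_⟩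
      rw [div_lt_iff₀ h.log_pos] at hm
      rw [len, ← Real.le_log_iff_exp_le hρ0]
      linarith [h.mul_log_le m]
    have hsub : cyl c m ω ⊆ closedBall x ρ := fun y hy => by
      have hx := hx m
      rw [mem_closedBall, Real.dist_eq, abs_le]
      simp only [cyl, mem_Icc] at hx hy
      constructor <;> linarith [hx.1, hx.2, hy.1, hy.2]
    have := ENNReal.toReal_mono (measure_ne_top μ _) (measure_mono (μ := μ) hsub)
    rw [h.measure_cyl hμ, ENNReal.toReal_ofReal (Real.exp_pos _).le] at this
    exact (Real.exp_pos _).trans_le this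
  have := Real.log_le_log hpos h₁
  rw [Real.log_exp] at this
  rw [logBall]; linarith

lemma Bounds.exists_lag (h : Bounds c r A B K) :
    ∃ m : ℕ, ∀ n, len c (n + m) < (1 - 2 / B) * len c n := by
  have hB : 0 < B := by linarith [h.two_lt]
  obtain ⟨m, hm⟩ := exists_pow_lt_of_lt_one h.gap_pos
    ((inv_lt_one₀ hB).2 (by linarith [h.two_lt] : (1 : ℝ) < B))
  refine ⟨m, fun n => ?_⟩
  have : len c (n + m) ≤ B⁻¹ ^ m * len c n := by
    clear hm
    induction m with
    | zero => simp
    | succ m ih =>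
      rw [← add_assoc, h.len_succ, pow_succ, div_eq_mul_inv, mul_right_comm]
      exact mul_le_mul ih (inv_anti₀ hB (h.le_ratio _)) (inv_nonneg.2 (h.ratio_pos _).le)
        (by have := len_pos c n; positivity)
  exact this.trans_lt (mul_lt_mul_of_pos_right hm (len_pos c n))

/-- The local dimension quotient. -/
noncomputable def ballDim (μ : Measure ℝ) (x ρ : ℝ) : ℝ :=
  Real.log (μ (closedBall x ρ)).toReal / Real.log ρ

/-- The local dimension quotient along the basic intervals. -/
noncomputable def cylDim (c r : ℕ → ℝ) (ω : ℕ → Bool) (n : ℕ) : ℝ :=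
  logMass r n ω / logLen c n

lemma ballDim_eq (μ : Measure ℝ) (x ρ : ℝ) : ballDim μ x ρ = logBall μ x ρ / (-Real.log ρ) := by
  rw [ballDim, logBall, neg_div_neg_eq]

lemma Bounds.cylDim_nonneg (h : Bounds c r A B K) (ω : ℕ → Bool) (n : ℕ) :
    0 ≤ cylDim c r ω n :=
  div_nonneg (h.logMass_nonneg n ω)
    ((mul_nonneg n.cast_nonneg h.log_pos.le).trans (h.mul_log_le n))

lemma Bounds.logLen_pos (h : Bounds c r A B K) {n : ℕ} (hn : 0 < n) : 0 < logLen c n :=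
  (mul_pos (Nat.cast_pos.2 hn) h.log_pos).trans_le (h.mul_log_le n)

lemma Bounds.cylDim_le (h : Bounds c r A B K) (ω : ℕ → Bool) (n : ℕ) :
    cylDim c r ω n ≤ K / Real.log B := by
  rcases Nat.eq_zero_or_pos n with rfl | hn
  · simpa [cylDim, logLen] using div_nonneg h.bound_nonneg h.log_pos.le
  · rw [cylDim, div_le_div_iff₀ (h.logLen_pos hn) h.log_pos]
    have h₁ := mul_le_mul_of_nonneg_right (h.logMass_le n ω) h.log_pos.le
    have h₂ := mul_le_mul_of_nonneg_left (h.mul_log_le n) h.bound_nonneg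
    linarith

lemma abs_div_sub_div_le {T R S L D C : ℝ} (hR : 0 < R) (hL : 0 < L) (hS0 : 0 ≤ S)
    (hS : S / L ≤ D) (hT : |T - S| ≤ C) (hRL : |R - L| ≤ C) :
    |T / R - S / L| ≤ C * (1 + D) / R := by
  have hC : 0 ≤ C := (abs_nonneg _).trans hT
  have : T / R - S / L = ((T - S) - S / L * (R - L)) / R := by field_simp; ring
  rw [this, abs_div, abs_of_pos hR]
  refine div_le_div_of_nonneg_right ?_ hR.le
  refine (abs_sub _ _).trans ?_
  rw [abs_mul, abs_of_nonneg (div_nonneg hS0 hL.le)]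
  have := mul_le_mul hS hRL (abs_nonneg _) ((div_nonneg hS0 hL.le).trans hS)
  linarith

lemma Bounds.eventually_ballDim (h : Bounds c r A B K) (hμ : HasCylMass μ c r) {ω : ℕ → Bool}
    {x : ℝ} (hx : ∀ n, x ∈ cyl c n ω) {ε : ℝ} (hε : 0 < ε) (n₀ : ℕ) :
    ∀ᶠ ρ in 𝓝[>] (0 : ℝ), ∃ n ≥ n₀, |ballDim μ x ρ - cylDim c r ω n| ≤ ε := by
  obtain ⟨m, hm⟩ := h.exists_lag
  set C := (m + 1) * K + Real.log A with hC
  have hA : 0 ≤ Real.log A := h.log_pos.le.trans ((h.log_le 0).trans (h.le_log 0))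
  have hlarge : ∀ᶠ ρ in 𝓝[>] (0 : ℝ),
      Real.log ρ ≤ -(C * (1 + K / Real.log B) / ε) :=
    Real.tendsto_log_nhdsGT_zero.eventually_le_atBot _
  have hsmall : ∀ᶠ ρ in 𝓝[>] (0 : ℝ), ρ < min (len c (m + n₀)) 1 :=
    nhdsWithin_le_nhds (eventually_lt_nhds (lt_min (len_pos _ _) one_pos))
  filter_upwards [hlarge, hsmall, self_mem_nhdsWithin] with ρ hlog hlt hρ0
  have hρ0 : 0 < ρ := hρ0
  have hρ1 : ρ < 1 := hlt.trans_le (min_le_right _ _)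
  have hρm : ρ < len c (m + n₀) := hlt.trans_le (min_le_left _ _)
  have hex : ∃ n, len c n ≤ ρ := by
    obtain ⟨n, hn⟩ := exists_nat_gt (-Real.log ρ / Real.log B)
    refine ⟨n, ?_⟩
    rw [div_lt_iff₀ h.log_pos] at hn
    rw [len, ← Real.le_log_iff_exp_le hρ0]
    linarith [h.mul_log_le n]
  obtain ⟨n, hn, hmin⟩ : ∃ n, len c n ≤ ρ ∧ ∀ k < n, ρ < len c k := by
    classical
    exact ⟨Nat.find hex, Nat.find_spec hex, fun k hk => not_le.1 (Nat.find_min hex hk)⟩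
  have hnm : m + n₀ < n := by
    by_contra hcon
    exact absurd (hρm.trans_le (h.len_anti (not_lt.1 hcon))) (not_lt.2 hn)
  obtain ⟨k, rfl⟩ : ∃ k, n = k + m + 1 := ⟨n - m - 1, by omega⟩
  refine ⟨k + m + 1, by omega, ?_⟩
  have hk := hmin (k + m) (Nat.lt_succ_self _)
  have hR : 0 < -Real.log ρ := neg_pos.2 (Real.log_neg hρ0 hρ1)
  have hL := h.logLen_pos (Nat.succ_pos (k + m))
  have h₁ := h.logBall_le hμ (hx _) hn
  have h₂ := h.le_logBall hμ hx hρ0 (hk.trans (hm k))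
  have h₃ := h.logMass_add_le k (m + 1) ω
  have h₄ : -Real.log ρ ≤ logLen c (k + m + 1) := by
    have := (Real.le_log_iff_exp_le hρ0).2 hn
    linarith
  have h₅ : logLen c (k + m) ≤ -Real.log ρ := by
    have := Real.log_le_log hρ0 hk.le
    rw [len, Real.log_exp] at this
    linarith
  have h₆ := logLen_succ c (k + m)
  have h₇ := h.le_log (k + m)
  have hmK : 0 ≤ (m + 1 : ℝ) * K := by have := h.bound_nonneg; positivity
  push_cast at h₃
  rw [← add_assoc] at h₃
  rw [ballDim_eq]
  refine (abs_div_sub_div_le (C := C) hR hL (h.logMass_nonneg _ ω) (h.cylDim_le ω _)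
    (abs_le.2 ⟨?_, ?_⟩) (abs_le.2 ⟨?_, ?_⟩)).trans ?_
  · linarith
  · linarith
  · simp only [Nat.succ_eq_add_one]; linarith
  · simp only [Nat.succ_eq_add_one]; linarith
  · rw [div_le_iff₀ hR]
    have : C * (1 + K / Real.log B) / ε ≤ -Real.log ρ := by linarith
    rw [div_le_iff₀ hε] at this
    linarith

lemma Bounds.eventually_ballDim_len (h : Bounds c r A B K) (hμ : HasCylMass μ c r)
    {ω : ℕ → Bool} {x : ℝ} (hx : ∀ n, x ∈ cyl c n ω) {ε : ℝ} (hε : 0 < ε) :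
    ∀ᶠ n in atTop, |ballDim μ x (len c n) - cylDim c r ω n| ≤ ε := by
  obtain ⟨m, hm⟩ := h.exists_lag
  set C := m * K with hC
  obtain ⟨n₁, hn₁⟩ := exists_nat_gt (C * (1 + K / Real.log B) / ε / Real.log B)
  filter_upwards [eventually_ge_atTop (m + n₁ + 1)] with n hn
  have hL := h.logLen_pos (show 0 < n by omega)
  have hR : -Real.log (len c n) = logLen c n := by rw [len, Real.log_exp, neg_neg]
  obtain ⟨k, rfl⟩ : ∃ k, n = k + m := ⟨n - m, by omega⟩
  have h₁ := h.logBall_le hμ (hx (k + m)) le_rfl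
  have h₂ := h.le_logBall hμ hx (len_pos c _) (hm k)
  have h₃ := h.logMass_add_le k m ω
  have hmK : 0 ≤ C := by have := h.bound_nonneg; positivity
  rw [ballDim_eq, hR]
  refine (abs_div_sub_div_le (C := C) hL hL (h.logMass_nonneg _ ω) (h.cylDim_le ω _)
    (abs_le.2 ⟨?_, ?_⟩) (by simpa using hmK)).trans ?_
  · linarith
  · linarith
  · rw [div_le_iff₀ hL]
    rw [div_lt_iff₀ h.log_pos, div_lt_iff₀ hε] at hn₁
    have h₈ : (n₁ : ℝ) * Real.log B ≤ logLen c (k + m) :=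
      le_trans (mul_le_mul_of_nonneg_right (Nat.cast_le.2 (by omega)) h.log_pos.le)
        (h.mul_log_le (k + m))
    have := mul_le_mul_of_nonneg_right h₈ hε.le
    linarith

lemma Bounds.tendsto_len (h : Bounds c r A B K) : Tendsto (len c) atTop (𝓝[>] 0) := by
  refine tendsto_nhdsWithin_iff.2 ⟨?_, Eventually.of_forall fun n => len_pos c n⟩
  refine Real.tendsto_exp_neg_atTop_nhds_zero.comp ?_
  exact tendsto_atTop_mono h.mul_log_le
    (tendsto_natCast_atTop_atTop.atTop_mul_const h.log_pos)

lemma Bounds.eventually_ballDim_mem (h : Bounds c r A B K) (hμ : HasCylMass μ c r)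
    {ω : ℕ → Bool} {x : ℝ} (hx : ∀ n, x ∈ cyl c n ω) :
    ∀ᶠ ρ in 𝓝[>] (0 : ℝ), -1 ≤ ballDim μ x ρ ∧ ballDim μ x ρ ≤ K / Real.log B + 1 := by
  filter_upwards [h.eventually_ballDim hμ hx one_pos 0] with ρ ⟨n, _, hn⟩
  rw [abs_le] at hn
  constructor <;> linarith [h.cylDim_nonneg ω n, h.cylDim_le ω n, hn.1, hn.2]

lemma Bounds.frequently_cylDim_le (h : Bounds c r A B K) (hμ : HasCylMass μ c r)
    {ω : ℕ → Bool} {x a ε : ℝ} (hx : ∀ n, x ∈ cyl c n ω) (ha : lowerLocalDim μ x = a)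
    (hε : 0 < ε) : ∃ᶠ n in atTop, cylDim c r ω n ≤ a + ε := by
  have hb := h.eventually_ballDim_mem hμ hx
  have hfreq : ∃ᶠ ρ in 𝓝[>] (0 : ℝ), ballDim μ x ρ < a + ε / 2 := by
    refine frequently_lt_of_liminf_lt
      (isBoundedUnder_of_eventually_le (hb.mono fun _ h => h.2)).isCoboundedUnder_ge ?_
    have : liminf (fun ρ => ballDim μ x ρ) (𝓝[>] 0) = a := ha
    linarith
  refine frequently_atTop.2 fun n₀ => ?_
  obtain ⟨ρ, hρ, n, hn, hle⟩ :=
    (hfreq.and_eventually (h.eventually_ballDim hμ hx (half_pos hε) n₀)).exists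
  exact ⟨n, hn, by linarith [(abs_le.1 hle).1]⟩

lemma Bounds.eventually_cylDim_le (h : Bounds c r A B K) (hμ : HasCylMass μ c r)
    {ω : ℕ → Bool} {x a ε : ℝ} (hx : ∀ n, x ∈ cyl c n ω) (ha : upperLocalDim μ x = a)
    (hε : 0 < ε) : ∀ᶠ n in atTop, cylDim c r ω n ≤ a + ε := by
  have hb := h.eventually_ballDim_mem hμ hx
  have hev : ∀ᶠ ρ in 𝓝[>] (0 : ℝ), ballDim μ x ρ < a + ε / 2 := by
    refine eventually_lt_of_limsup_lt ?_
      (isBoundedUnder_of_eventually_le (hb.mono fun _ h => h.2))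
    have : limsup (fun ρ => ballDim μ x ρ) (𝓝[>] 0) = a := ha
    linarith
  filter_upwards [h.tendsto_len.eventually hev,
    h.eventually_ballDim_len hμ hx (half_pos hε)] with n h₁ h₂
  linarith [(abs_le.1 h₂).1]

lemma Bounds.lowerLocalDim_eq (h : Bounds c r A B K) (hμ : HasCylMass μ c r)
    {ω : ℕ → Bool} {x a : ℝ} (hx : ∀ n, x ∈ cyl c n ω)
    (hge : ∀ ε > 0, ∀ᶠ n in atTop, a - ε ≤ cylDim c r ω n)
    (hle : ∀ ε > 0, ∃ᶠ n in atTop, cylDim c r ω n ≤ a + ε) : lowerLocalDim μ x = a := by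
  have hb := h.eventually_ballDim_mem hμ hx
  refine le_antisymm (le_of_forall_pos_le_add fun ε hε => ?_)
    (le_of_forall_pos_sub_le fun ε hε => ?_)
  · refine liminf_le_of_frequently_le (u := ballDim μ x) ?_
      (isBoundedUnder_of_eventually_ge (hb.mono fun _ h => h.1))
    refine h.tendsto_len.frequently (((hle (ε / 2) (half_pos hε)).and_eventually
      (h.eventually_ballDim_len hμ hx (half_pos hε))).mono fun n hn => ?_)
    linarith [(abs_le.1 hn.2).2, hn.1]
  · refine le_liminf_of_le (u := ballDim μ x)
      (isBoundedUnder_of_eventually_le (hb.mono fun _ h => h.2)).isCoboundedUnder_ge ?_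
    obtain ⟨n₀, hn₀⟩ := eventually_atTop.1 (hge (ε / 2) (half_pos hε))
    filter_upwards [h.eventually_ballDim hμ hx (half_pos hε) n₀] with ρ ⟨n, hn, hd⟩
    linarith [(abs_le.1 hd).1, hn₀ n hn]

lemma Bounds.upperLocalDim_eq (h : Bounds c r A B K) (hμ : HasCylMass μ c r)
    {ω : ℕ → Bool} {x a : ℝ} (hx : ∀ n, x ∈ cyl c n ω)
    (hle : ∀ ε > 0, ∀ᶠ n in atTop, cylDim c r ω n ≤ a + ε)
    (hge : ∀ ε > 0, ∃ᶠ n in atTop, a - ε ≤ cylDim c r ω n) : upperLocalDim μ x = a := by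
  have hb := h.eventually_ballDim_mem hμ hx
  refine le_antisymm (le_of_forall_pos_le_add fun ε hε => ?_)
    (le_of_forall_pos_sub_le fun ε hε => ?_)
  · refine limsup_le_of_le (u := ballDim μ x)
      (isBoundedUnder_of_eventually_ge (hb.mono fun _ h => h.1)).isCoboundedUnder_le ?_
    obtain ⟨n₀, hn₀⟩ := eventually_atTop.1 (hle (ε / 2) (half_pos hε))
    filter_upwards [h.eventually_ballDim hμ hx (half_pos hε) n₀] with ρ ⟨n, hn, hd⟩
    linarith [(abs_le.1 hd).2, hn₀ n hn]
  · refine le_limsup_of_frequently_le (u := ballDim μ x) ?_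
      (isBoundedUnder_of_eventually_le (hb.mono fun _ h => h.2))
    refine h.tendsto_len.frequently (((hge (ε / 2) (half_pos hε)).and_eventually
      (h.eventually_ballDim_len hμ hx (half_pos hε))).mono fun n hn => ?_)
    linarith [(abs_le.1 hn.2).1, hn.1]

end Moran

namespace Moran

variable {c r : ℕ → ℝ} {A B K : ℝ}

lemma Bounds.dimH_le_of_cover (h : Bounds c r A B K) {E : Set ℝ} {d : ℝ} (hd : 0 ≤ d)
    (good : ∀ n, Set (Fin n → Bool))
    (hE : ∀ x ∈ E, ∃ᶠ n in atTop, ∃ v ∈ good n, x ∈ cyl c n (extend v))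
    (W : ∀ n, (Fin n → Bool) → ℝ) (hW : ∀ n v, 0 ≤ W n v)
    (hgood : ∀ n, ∀ v ∈ good n, Real.exp (-(d * logLen c n)) ≤ W n v)
    {a : ℕ → ℝ} (ha : Summable a) (hWa : ∀ n, ∑ v, W n v ≤ a n) :
    dimH E ≤ ENNReal.ofReal d := by
  classical
  have ha0 : ∀ n, 0 ≤ a n := fun n => (Finset.sum_nonneg fun v _ => hW n v).trans (hWa n)
  have hdiam : ∀ n (ω : ℕ → Bool), ediam (cyl c n ω) = ENNReal.ofReal (len c n) := fun n ω => by
    rw [cyl, Real.ediam_Icc]; congr 1; ring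
  have hle : μH[d] E ≤ liminf (fun m =>
      ∑' i : (Σ n : ℕ, {v : Fin (n + m) → Bool // v ∈ good (n + m)}),
      ediam (cyl c (i.1 + m) (extend i.2.1)) ^ d) atTop := by
    refine Measure.hausdorffMeasure_le_liminf_tsum d E (fun m => ENNReal.ofReal (len c m)) ?_
      (fun m (i : Σ n : ℕ, {v : Fin (n + m) → Bool // v ∈ good (n + m)}) =>
        cyl c (i.1 + m) (extend i.2.1)) ?_ ?_
    · rw [← ENNReal.ofReal_zero]
      refine ENNReal.tendsto_ofReal ?_
      refine Real.tendsto_exp_neg_atTop_nhds_zero.comp ?_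
      exact tendsto_atTop_mono h.mul_log_le
        (tendsto_natCast_atTop_atTop.atTop_mul_const h.log_pos)
    · refine Eventually.of_forall fun m i => ?_
      rw [hdiam]
      exact ENNReal.ofReal_le_ofReal (h.len_anti (Nat.le_add_left _ _))
    · refine Eventually.of_forall fun m x hx => ?_
      obtain ⟨n, hn, v, hv, hxv⟩ := frequently_atTop.1 (hE x hx) m
      obtain ⟨k, rfl⟩ := Nat.exists_eq_add_of_le' hn
      exact mem_iUnion.2 ⟨⟨k, v, hv⟩, hxv⟩
  have hsum : ∀ m, (∑' i : (Σ n : ℕ, {v : Fin (n + m) → Bool // v ∈ good (n + m)}),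
      ediam (cyl c (i.1 + m) (extend i.2.1)) ^ d) ≤ ENNReal.ofReal (∑' n, a (n + m)) := by
    intro m
    rw [ENNReal.tsum_sigma', ENNReal.ofReal_tsum_of_nonneg (fun n => ha0 _)
      ((summable_nat_add_iff m).2 ha)]
    refine ENNReal.tsum_le_tsum fun n => ?_
    refine le_trans ?_ (ENNReal.ofReal_le_ofReal (hWa (n + m)))
    rw [ENNReal.ofReal_sum_of_nonneg fun v _ => hW _ v, ← tsum_fintype (L := .unconditional _)]
    refine le_trans (ENNReal.tsum_le_tsum fun v => ?_)
      (ENNReal.tsum_comp_le_tsum_of_injective Subtype.val_injective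
        fun v => ENNReal.ofReal (W (n + m) v))
    rw [hdiam, ENNReal.ofReal_rpow_of_pos (len_pos _ _)]
    refine ENNReal.ofReal_le_ofReal (le_trans (le_of_eq ?_) (hgood _ _ v.2))
    rw [len, ← Real.exp_mul]; congr 1; ring
  have hlim : Tendsto (fun m => ENNReal.ofReal (∑' n, a (n + m))) atTop (𝓝 0) := by
    rw [← ENNReal.ofReal_zero]
    exact ENNReal.tendsto_ofReal (tendsto_sum_nat_add a)
  have hzero : μH[d] E = 0 := by
    refine le_antisymm (hle.trans ?_) zero_le
    refine (liminf_le_liminf (Eventually.of_forall hsum)).trans_eq hlim.liminf_eq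
  have : μH[((d.toNNReal : NNReal) : ℝ)] E ≠ ⊤ := by
    rw [Real.coe_toNNReal d hd, hzero]; exact ENNReal.zero_ne_top
  exact dimH_le_of_hausdorffMeasure_ne_top this

/-- The logarithm of the partition function `ρ ^ s + (1 - ρ) ^ s`. -/
noncomputable def logPart (ρ s : ℝ) : ℝ := Real.log (ρ ^ s + (1 - ρ) ^ s)

lemma part_pos {ρ : ℝ} (h0 : 0 < ρ) (h1 : ρ < 1) (s : ℝ) : 0 < ρ ^ s + (1 - ρ) ^ s :=
  add_pos (Real.rpow_pos_of_pos h0 _) (Real.rpow_pos_of_pos (by linarith) _)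

lemma Bounds.sum_exp_neg_mul_cost (h : Bounds c r A B K) (n : ℕ) (σ : ℕ → ℝ) :
    ∑ v : Fin n → Bool, Real.exp (-∑ k ∈ Finset.range n, σ k * cost r k (extend v k)) =
      Real.exp (∑ k ∈ Finset.range n, logPart (r (k + 1)) (σ k)) := by
  simp_rw [← Finset.sum_neg_distrib, Real.exp_sum]
  rw [sum_prod_extend n fun k b => Real.exp (-(σ k * cost r k b))]
  refine Finset.prod_congr rfl fun k _ => ?_
  have h0 := h.weight_pos k
  have h1 := h.weight_lt_one k
  have key : ∀ b, Real.exp (-(σ k * cost r k b)) =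
      (if b then 1 - r (k + 1) else r (k + 1)) ^ σ k := fun b => by
    rw [← h.exp_neg_cost, ← Real.exp_mul]; congr 1; ring
  rw [key, key, logPart, Real.exp_log (part_pos h0 h1 _), add_comm]
  simp

lemma Bounds.dimH_le_of_weights (h : Bounds c r A B K) {E : Set ℝ} {d δ : ℝ} (hd : 0 ≤ d)
    (hδ : 0 < δ) (lev : Set ℕ) (σ : ℕ → ℕ → ℝ) (Q : ℕ → ℝ)
    (hE : ∀ x ∈ E, ∃ ω, (∀ n, x ∈ cyl c n ω) ∧ ∃ᶠ n in atTop, n ∈ lev ∧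
      ∑ k ∈ Finset.range n, σ n k * cost r k (ω k) ≤ Q n)
    (hQ : ∀ n ∈ lev, Q n + ∑ k ∈ Finset.range n, logPart (r (k + 1)) (σ n k) - d * logLen c n ≤
      -(δ * n)) : dimH E ≤ ENNReal.ofReal d := by
  classical
  refine h.dimH_le_of_cover hd
    (fun n => {v | n ∈ lev ∧ ∑ k ∈ Finset.range n, σ n k * cost r k (extend v k) ≤ Q n}) ?_
    (fun n v => if n ∈ lev then Real.exp (-(d * logLen c n)) *
      (Real.exp (Q n) * Real.exp (-∑ k ∈ Finset.range n, σ n k * cost r k (extend v k))) else 0)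
    ?_ ?_ (a := fun n => Real.exp (-δ) ^ n)
    (summable_geometric_of_lt_one (Real.exp_pos _).le (Real.exp_lt_one_iff.2 (by linarith))) ?_
  · intro x hx
    obtain ⟨ω, hω, hfreq⟩ := hE x hx
    refine hfreq.mono fun n hn => ⟨fun i => ω i, ⟨hn.1, le_of_eq_of_le ?_ hn.2⟩, ?_⟩
    · exact Finset.sum_congr rfl fun k hk => by
        rw [extend_restrict n ω k (Finset.mem_range.1 hk)]
    · rw [cyl_congr c (extend_restrict n ω)]; exact hω n
  · intro n v
    split_ifs <;> positivity
  · rintro n v ⟨hn, hv⟩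
    rw [if_pos hn, ← Real.exp_add, ← Real.exp_add]
    exact Real.exp_le_exp.2 (by linarith)
  · intro n
    by_cases hn : n ∈ lev
    · simp only [hn, if_true]
      rw [← Finset.mul_sum, ← Finset.mul_sum, h.sum_exp_neg_mul_cost, ← Real.exp_add,
        ← Real.exp_add, ← Real.exp_nat_mul]
      refine Real.exp_le_exp.2 ?_
      linarith [hQ n hn]
    · simp only [hn, if_false, Finset.sum_const_zero]
      positivity

end Moran

namespace Moran

/-- The sequences `c` and `r` are constant on the blocks `(N i, N (i + 1)]`, with alternating
values `A`, `B` and `p`, `q`, and the lengths of the blocks grow superexponentially. -/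
structure Blocks (N : ℕ → ℕ) (c r : ℕ → ℝ) (A B p q : ℝ) : Prop where
  lt : B < A
  two_lt : 2 < B
  p_pos : 0 < p
  p_le : p ≤ 1 / 2
  q_pos : 0 < q
  q_le : q ≤ 1 / 2
  zero : N 0 = 0
  mono : StrictMono N
  lim : Tendsto (fun i : ℕ => (N (i + 1) : ℝ) / (N i : ℝ)) atTop atTop
  ratio_even : ∀ i n : ℕ, N (2 * i) < n → n ≤ N (2 * i + 1) → c n = A
  ratio_odd : ∀ i n : ℕ, N (2 * i + 1) < n → n ≤ N (2 * i + 2) → c n = B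
  weight_even : ∀ i n : ℕ, N (2 * i) < n → n ≤ N (2 * i + 1) → r n = p
  weight_odd : ∀ i n : ℕ, N (2 * i + 1) < n → n ≤ N (2 * i + 2) → r n = q

/-- `k` lies in a block with an even index. -/
def InEven (N : ℕ → ℕ) (k : ℕ) : Prop := ∃ i, N (2 * i) ≤ k ∧ k < N (2 * i + 1)

open Classical in
/-- The number of `k < n` in blocks with an even index. -/
noncomputable def evenCount (N : ℕ → ℕ) (n : ℕ) : ℝ :=
  ∑ k ∈ Finset.range n, if InEven N k then 1 else 0

variable {N : ℕ → ℕ} {c r : ℕ → ℝ} {A B p q : ℝ}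

lemma Blocks.exists_block (h : Blocks N c r A B p q) (k : ℕ) : ∃ j, N j ≤ k ∧ k < N (j + 1) := by
  classical
  have hex : ∃ j, k < N (j + 1) := ⟨k, h.mono.le_apply⟩
  refine ⟨Nat.find hex, ?_, Nat.find_spec hex⟩
  rcases Nat.eq_zero_or_pos (Nat.find hex) with h0 | h0
  · rw [h0, h.zero]; exact Nat.zero_le _
  · have := Nat.find_min hex (Nat.sub_lt h0 one_pos)
    rw [show Nat.find hex - 1 + 1 = Nat.find hex by omega] at this
    exact not_lt.1 this

lemma Blocks.not_inEven (h : Blocks N c r A B p q) {i k : ℕ} (h₁ : N (2 * i + 1) ≤ k)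
    (h₂ : k < N (2 * i + 2)) : ¬ InEven N k := by
  rintro ⟨j, h₃, h₄⟩
  have := h.mono.lt_iff_lt.1 (h₁.trans_lt h₄)
  have := h.mono.lt_iff_lt.1 (h₃.trans_lt h₂)
  omega

lemma Blocks.exists_of_not_inEven (h : Blocks N c r A B p q) {k : ℕ} (hk : ¬ InEven N k) :
    ∃ i, N (2 * i + 1) ≤ k ∧ k < N (2 * i + 2) := by
  obtain ⟨j, hj⟩ := h.exists_block k
  rcases Nat.even_or_odd' j with ⟨i, rfl | rfl⟩
  · exact absurd ⟨i, hj⟩ hk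
  · exact ⟨i, hj⟩

open Classical in
lemma Blocks.ratio_eq (h : Blocks N c r A B p q) (k : ℕ) :
    c (k + 1) = if InEven N k then A else B := by
  split_ifs with hk
  · obtain ⟨i, h₁, h₂⟩ := hk
    exact h.ratio_even i _ (by omega) (by omega)
  · obtain ⟨i, h₁, h₂⟩ := h.exists_of_not_inEven hk
    exact h.ratio_odd i _ (by omega) (by omega)

open Classical in
lemma Blocks.weight_eq (h : Blocks N c r A B p q) (k : ℕ) :
    r (k + 1) = if InEven N k then p else q := by
  split_ifs with hk
  · obtain ⟨i, h₁, h₂⟩ := hk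
    exact h.weight_even i _ (by omega) (by omega)
  · obtain ⟨i, h₁, h₂⟩ := h.exists_of_not_inEven hk
    exact h.weight_odd i _ (by omega) (by omega)

lemma neg_log_one_sub_le {ρ : ℝ} (h0 : 0 < ρ) (h : ρ ≤ 1 / 2) :
    -Real.log (1 - ρ) ≤ -Real.log ρ :=
  neg_le_neg (Real.log_le_log h0 (by linarith))

lemma Blocks.bounds (h : Blocks N c r A B p q) :
    Bounds c r A B (-Real.log p + -Real.log q) where
  two_lt := h.two_lt
  le_ratio k := by
    classical
    rw [h.ratio_eq]; split_ifs
    exacts [h.lt.le, le_rfl]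
  ratio_le k := by
    classical
    rw [h.ratio_eq]; split_ifs
    exacts [le_rfl, h.lt.le]
  weight_pos k := by
    classical
    rw [h.weight_eq]; split_ifs
    exacts [h.p_pos, h.q_pos]
  weight_lt_one k := by
    classical
    rw [h.weight_eq]; split_ifs <;> linarith [h.p_le, h.q_le]
  cost_le k b := by
    classical
    have h₁ := neg_log_one_sub_le h.p_pos h.p_le
    have h₂ := neg_log_one_sub_le h.q_pos h.q_le
    have h₃ := Real.log_nonpos h.p_pos.le (by linarith [h.p_le])
    have h₄ := Real.log_nonpos h.q_pos.le (by linarith [h.q_le])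
    rw [cost, h.weight_eq]
    split_ifs <;> linarith

open Classical in
lemma sum_ite_inEven (N : ℕ → ℕ) (a b : ℝ) (n : ℕ) :
    ∑ k ∈ Finset.range n, (if InEven N k then a else b) =
      a * evenCount N n + b * (n - evenCount N n) := by
  have : ∀ k, (if InEven N k then a else b) = b + (a - b) * if InEven N k then 1 else 0 := by
    intro k; split_ifs <;> ring
  simp_rw [this, Finset.sum_add_distrib, ← Finset.mul_sum]
  rw [← evenCount, Finset.sum_const, Finset.card_range, nsmul_eq_mul]
  ring

lemma Blocks.logLen_eq (h : Blocks N c r A B p q) (n : ℕ) :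
    logLen c n = Real.log A * evenCount N n + Real.log B * (n - evenCount N n) := by
  classical
  rw [← sum_ite_inEven, logLen]
  exact Finset.sum_congr rfl fun k _ => by rw [h.ratio_eq]; split_ifs <;> rfl

lemma Blocks.sum_logPart (h : Blocks N c r A B p q) (s : ℝ) (n : ℕ) :
    ∑ k ∈ Finset.range n, logPart (r (k + 1)) s =
      logPart p s * evenCount N n + logPart q s * (n - evenCount N n) := by
  classical
  rw [← sum_ite_inEven]
  exact Finset.sum_congr rfl fun k _ => by rw [h.weight_eq]; split_ifs <;> rfl

lemma evenCount_nonneg (N : ℕ → ℕ) (n : ℕ) : 0 ≤ evenCount N n := by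
  classical
  exact Finset.sum_nonneg fun k _ => by split_ifs <;> norm_num

lemma evenCount_le (N : ℕ → ℕ) (n : ℕ) : evenCount N n ≤ n := by
  classical
  have := Finset.sum_le_card_nsmul (Finset.range n)
    (fun k => if InEven N k then (1 : ℝ) else 0) 1 fun k _ => by split_ifs <;> norm_num
  simpa [evenCount] using this

lemma evenCount_add_of_forall {m n : ℕ} (hmn : m ≤ n)
    (h : ∀ k, m ≤ k → k < n → InEven N k) : evenCount N n = evenCount N m + (n - m) := by
  classical
  rw [evenCount, ← Finset.sum_range_add_sum_Ico _ hmn, ← evenCount,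
    Finset.sum_congr rfl fun k hk =>
      if_pos (h k (Finset.mem_Ico.1 hk).1 (Finset.mem_Ico.1 hk).2)]
  simp [Nat.cast_sub hmn]

lemma evenCount_eq_of_forall {m n : ℕ} (hmn : m ≤ n)
    (h : ∀ k, m ≤ k → k < n → ¬ InEven N k) : evenCount N n = evenCount N m := by
  classical
  rw [evenCount, ← Finset.sum_range_add_sum_Ico _ hmn, ← evenCount,
    Finset.sum_congr rfl fun k hk =>
      if_neg (h k (Finset.mem_Ico.1 hk).1 (Finset.mem_Ico.1 hk).2)]
  simp

lemma evenCount_of_even {i n : ℕ} (h₁ : N (2 * i) ≤ n)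
    (h₂ : n ≤ N (2 * i + 1)) : evenCount N n = evenCount N (N (2 * i)) + (n - N (2 * i)) :=
  evenCount_add_of_forall h₁ fun _ hk hk' => ⟨i, hk, hk'.trans_le h₂⟩

lemma Blocks.evenCount_even_le (h : Blocks N c r A B p q) (i : ℕ) :
    evenCount N (N (2 * i + 2)) ≤ N (2 * i + 1) := by
  rw [evenCount_eq_of_forall (h.mono.monotone (Nat.le_succ (2 * i + 1)))
    fun k hk hk' => h.not_inEven hk hk']
  exact evenCount_le N _

lemma Blocks.sub_evenCount_odd_le (h : Blocks N c r A B p q) (i : ℕ) :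
    N (2 * i + 1) - evenCount N (N (2 * i + 1)) ≤ N (2 * i) := by
  rw [evenCount_of_even (h.mono.monotone (Nat.le_succ (2 * i))) le_rfl]
  linarith [evenCount_nonneg N (N (2 * i))]

lemma Blocks.eventually_le_mul (h : Blocks N c r A B p q) {ε : ℝ} (hε : 0 < ε) :
    ∀ᶠ i in atTop, (N i : ℝ) ≤ ε * N (i + 1) := by
  filter_upwards [h.lim.eventually_ge_atTop ε⁻¹, eventually_ge_atTop 1] with i hi hi1
  have hpos : (0 : ℝ) < N i := by
    have : i ≤ N i := h.mono.le_apply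
    exact_mod_cast (show 0 < N i by omega)
  rw [le_div_iff₀ hpos, inv_mul_le_iff₀ hε] at hi
  exact hi

/-- At the ends of the odd-indexed blocks, the even-indexed blocks are negligible. -/
lemma Blocks.eventually_evenCount_le (h : Blocks N c r A B p q) {ε : ℝ} (hε : 0 < ε) :
    ∀ᶠ i in atTop, evenCount N (N (2 * i)) ≤ ε * N (2 * i) := by
  obtain ⟨i₀, hi₀⟩ := eventually_atTop.1 (h.eventually_le_mul hε)
  filter_upwards [eventually_ge_atTop (i₀ + 1)] with i hi
  obtain ⟨j, rfl⟩ : ∃ j, i = j + 1 := ⟨i - 1, by omega⟩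
  exact (h.evenCount_even_le j).trans (hi₀ (2 * j + 1) (by omega))

/-- At the ends of the even-indexed blocks, the odd-indexed blocks are negligible. -/
lemma Blocks.eventually_sub_evenCount_le (h : Blocks N c r A B p q) {ε : ℝ} (hε : 0 < ε) :
    ∀ᶠ i in atTop, N (2 * i + 1) - evenCount N (N (2 * i + 1)) ≤ ε * N (2 * i + 1) := by
  obtain ⟨i₀, hi₀⟩ := eventually_atTop.1 (h.eventually_le_mul hε)
  filter_upwards [eventually_ge_atTop i₀] with i hi
  exact (h.sub_evenCount_odd_le i).trans (hi₀ (2 * i) (by omega))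

end Moran

namespace Moran

variable {N : ℕ → ℕ} {c r : ℕ → ℝ} {A B K p q : ℝ} {μ : Measure ℝ}

/-- The points of the Moran set with given lower and upper local dimensions. -/
def localDimSet (μ : Measure ℝ) (c : ℕ → ℝ) (α α' : ℝ) : Set ℝ :=
  {x | x ∈ moranSet c ∧ lowerLocalDim μ x = α ∧ upperLocalDim μ x = α'}

lemma Bounds.logMass_le_of_cylDim_le (h : Bounds c r A B K) {ω : ℕ → Bool} {n : ℕ} {a : ℝ}
    (hn : cylDim c r ω n ≤ a) : logMass r n ω ≤ a * logLen c n := by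
  rcases Nat.eq_zero_or_pos n with rfl | hn0
  · simp [logMass, logLen]
  · rwa [cylDim, div_le_iff₀ (h.logLen_pos hn0)] at hn

lemma Blocks.logPart_fst (h : Blocks N c r A B p q) (s : ℝ) :
    logPart p s = -(betaFn p A s * Real.log A) := by
  have : Real.log A ≠ 0 := (Real.log_pos (by linarith [h.two_lt, h.lt])).ne'
  rw [betaFn, div_mul_cancel₀ _ this, neg_neg, logPart]

lemma Blocks.logPart_snd (h : Blocks N c r A B p q) (s : ℝ) :
    logPart q s = -(betaFn q B s * Real.log B) := by
  rw [betaFn, div_mul_cancel₀ _ h.bounds.log_pos.ne', neg_neg, logPart]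

lemma Blocks.log_pos (h : Blocks N c r A B p q) : 0 < Real.log A :=
  Real.log_pos (by linarith [h.two_lt, h.lt])

lemma mul_le_of_le_div {M ε x y : ℝ} (hM : 0 ≤ M) (hε : 0 < ε) (hy : 0 ≤ y)
    (hxy : x ≤ ε / (M + 1) * y) : M * x ≤ ε * y := by
  have h₁ := mul_le_mul_of_nonneg_left hxy hM
  have h₂ : M * (ε / (M + 1) * y) = M / (M + 1) * (ε * y) := by ring
  have h₃ : M / (M + 1) ≤ 1 := (div_le_one (by linarith)).2 (by linarith)
  have h₄ := mul_le_mul_of_nonneg_right h₃ (mul_nonneg hε.le hy)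
  linarith

lemma Blocks.dimH_le_odd [IsProbabilityMeasure μ] (h : Blocks N c r A B p q)
    (hμ : HasCylMass μ c r) {α α' s ε : ℝ}
    (hs : 0 ≤ s) (hε : 0 < ε) (hD : 0 ≤ s * α' - betaFn q B s) :
    dimH (localDimSet μ c α α') ≤ ENNReal.ofReal (s * α' - betaFn q B s + ε) := by
  have hb := h.bounds
  set M := |betaFn q B s - betaFn p A s| * Real.log A with hM
  have hM0 : 0 ≤ M := mul_nonneg (abs_nonneg _) h.log_pos.le
  have hδ : 0 < ε * Real.log B / 4 := by have := hb.log_pos; positivity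
  obtain ⟨i₀, hi₀⟩ := eventually_atTop.1 (h.eventually_evenCount_le
    (show 0 < ε * Real.log B / 4 / (M + 1) by positivity))
  set η := ε / 2 / (s + 1) with hη
  have hη0 : 0 < η := by positivity
  refine hb.dimH_le_of_weights (by linarith) hδ {n | ∃ i ≥ i₀, n = N (2 * i)} (fun _ _ => s)
    (fun n => s * ((α' + η) * logLen c n)) ?_ ?_
  · rintro x ⟨hx, -, hup⟩
    obtain ⟨ω, hω⟩ := hb.exists_code hx
    refine ⟨ω, hω, frequently_atTop.2 fun n₀ => ?_⟩
    obtain ⟨n₁, hn₁⟩ := eventually_atTop.1 (hb.eventually_cylDim_le hμ hω hup hη0)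
    have hle : n₀ + n₁ + i₀ ≤ N (2 * (n₀ + n₁ + i₀)) :=
      (by omega : n₀ + n₁ + i₀ ≤ 2 * (n₀ + n₁ + i₀)).trans h.mono.le_apply
    refine ⟨N (2 * (n₀ + n₁ + i₀)), by omega, ⟨_, by omega, rfl⟩, ?_⟩
    rw [← Finset.mul_sum]
    exact mul_le_mul_of_nonneg_left
      (hb.logMass_le_of_cylDim_le (hn₁ _ (by omega))) hs
  · rintro n ⟨i, hi, rfl⟩
    have h₁ := mul_le_of_le_div hM0 hδ (Nat.cast_nonneg _) (hi₀ i hi)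
    set n := N (2 * i)
    have h₂ : (betaFn q B s - betaFn p A s) * Real.log A * evenCount N n ≤ M * evenCount N n :=
      mul_le_mul_of_nonneg_right
        (mul_le_mul_of_nonneg_right (le_abs_self _) h.log_pos.le) (evenCount_nonneg N n)
    have h₃ : s * η * logLen c n ≤ ε / 2 * logLen c n := by
      rw [mul_assoc]
      refine mul_le_of_le_div hs (half_pos hε) ?_ le_rfl
      exact (mul_nonneg n.cast_nonneg hb.log_pos.le).trans (hb.mul_log_le n)
    have h₄ := mul_le_mul_of_nonneg_left (hb.mul_log_le n) (half_pos hε).le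
    have h₅ : (betaFn q B s - betaFn p A s) * Real.log A * evenCount N n =
        betaFn q B s * logLen c n + (logPart p s * evenCount N n +
          logPart q s * (n - evenCount N n)) := by
      rw [h.logLen_eq, h.logPart_fst, h.logPart_snd]; ring
    rw [h.sum_logPart]
    linarith

lemma Blocks.dimH_le_even (h : Blocks N c r A B p q) (α α' : ℝ) {ε : ℝ} (hε : 0 < ε) :
    dimH (localDimSet μ c α α') ≤ ENNReal.ofReal (Real.log 2 / Real.log A + ε) := by
  have hb := h.bounds
  have hlA := h.log_pos
  have hl2 : 0 < Real.log 2 := Real.log_pos one_lt_two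
  have hδ : 0 < ε * Real.log B / 2 := by have := hb.log_pos; positivity
  obtain ⟨i₀, hi₀⟩ := eventually_atTop.1 (h.eventually_sub_evenCount_le
    (show 0 < ε * Real.log B / 2 / (Real.log 2 + 1) by positivity))
  refine hb.dimH_le_of_weights (by positivity) hδ {n | ∃ i ≥ i₀, n = N (2 * i + 1)}
    (fun _ _ => 0) (fun n => 0) ?_ ?_
  · rintro x ⟨hx, -, -⟩
    obtain ⟨ω, hω⟩ := hb.exists_code hx
    refine ⟨ω, hω, frequently_atTop.2 fun n₀ => ?_⟩
    have hle : n₀ + i₀ ≤ N (2 * (n₀ + i₀) + 1) :=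
      (by omega : n₀ + i₀ ≤ 2 * (n₀ + i₀) + 1).trans h.mono.le_apply
    exact ⟨N (2 * (n₀ + i₀) + 1), by omega, ⟨_, by omega, rfl⟩, by simp⟩
  · rintro n ⟨i, hi, rfl⟩
    have h₁ := mul_le_of_le_div hl2.le hδ (Nat.cast_nonneg _) (hi₀ i hi)
    set n := N (2 * i + 1)
    have h₀ : ∀ ρ : ℝ, logPart ρ 0 = Real.log 2 := fun ρ => by
      rw [logPart, Real.rpow_zero, Real.rpow_zero]; norm_num
    have h₂ : Real.log A * evenCount N n ≤ logLen c n := by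
      rw [h.logLen_eq]
      have := mul_nonneg hb.log_pos.le (sub_nonneg.2 (evenCount_le N n))
      linarith
    have h₃ : Real.log 2 * evenCount N n ≤ Real.log 2 / Real.log A * logLen c n := by
      have := mul_le_mul_of_nonneg_left h₂ (show 0 ≤ Real.log 2 / Real.log A by positivity)
      rwa [← mul_assoc, div_mul_cancel₀ _ hlA.ne'] at this
    have h₄ := mul_le_mul_of_nonneg_left (hb.mul_log_le n) hε.le
    rw [h.sum_logPart, h₀, h₀]
    have : 0 ≤ (n : ℝ) * (ε * Real.log B / 2) := by positivity
    linarith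

/-- The lower local dimension is attained, up to `ε`, along levels inside even-indexed blocks. -/
lemma Blocks.frequently_even (h : Blocks N c r A B p q) {ω : ℕ → Bool} {a : ℝ}
    (ha : a < -Real.log (1 - q) / Real.log B)
    (hfreq : ∃ᶠ n in atTop, logMass r n ω ≤ a * logLen c n) (n₀ : ℕ) :
    ∃ n ≥ n₀, (∃ i, N (2 * i) < n ∧ n ≤ N (2 * i + 1)) ∧ logMass r n ω ≤ a * logLen c n := by
  have hb := h.bounds
  obtain ⟨n, hn, hle⟩ := frequently_atTop.1 hfreq (N (n₀ + 1) + 1)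
  obtain ⟨j, hj₁, hj₂⟩ := h.exists_block (n - 1)
  have hj : n₀ + 1 < j + 1 := h.mono.lt_iff_lt.1 (lt_of_le_of_lt (by omega) hj₂)
  have hjN : j ≤ N j := h.mono.le_apply
  rcases Nat.even_or_odd' j with ⟨i, rfl | rfl⟩
  · exact ⟨n, by omega, ⟨i, by omega, by omega⟩, hle⟩
  · rw [show 2 * i + 1 + 1 = 2 * i + 2 by ring] at hj₂
    refine ⟨N (2 * i + 1), by omega, ⟨i, h.mono (Nat.lt_succ_self _), le_rfl⟩, ?_⟩
    have hmn : N (2 * i + 1) ≤ n := by omega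
    have hcost : ∀ k ∈ Finset.Ico (N (2 * i + 1)) n, -Real.log (1 - q) ≤ cost r k (ω k) := by
      intro k hk
      rw [Finset.mem_Ico] at hk
      have hodd : ¬ InEven N k := h.not_inEven hk.1 (by omega)
      rw [cost, h.weight_eq, if_neg hodd]
      have := neg_log_one_sub_le h.q_pos h.q_le
      split_ifs <;> linarith
    have h₁ : logMass r n ω = logMass r (N (2 * i + 1)) ω +
        ∑ k ∈ Finset.Ico (N (2 * i + 1)) n, cost r k (ω k) :=
      (Finset.sum_range_add_sum_Ico _ hmn).symm
    have h₂ := Finset.card_nsmul_le_sum _ _ _ hcost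
    rw [Nat.card_Ico, nsmul_eq_mul, Nat.cast_sub hmn] at h₂
    have h₃ : logLen c n = logLen c (N (2 * i + 1)) + Real.log B * (n - N (2 * i + 1)) := by
      rw [h.logLen_eq, h.logLen_eq, evenCount_eq_of_forall hmn
        fun k hk hk' => h.not_inEven hk (by omega)]
      ring
    rw [lt_div_iff₀ hb.log_pos] at ha
    have h₄ := mul_le_mul_of_nonneg_right ha.le (sub_nonneg.2 (Nat.cast_le (α := ℝ).2 hmn))
    rw [h₁, h₃] at hle
    linarith

lemma Blocks.dimH_le_mixed [IsProbabilityMeasure μ] (h : Blocks N c r A B p q)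
    (hμ : HasCylMass μ c r)
    {α α' s t ε : ℝ} (hs : 0 ≤ s) (hst : s ≤ t) (hε : 0 < ε)
    (hα : α < -Real.log (1 - q) / Real.log B)
    (hD : 0 ≤ s * α - betaFn p A s)
    (hg : t * α' - betaFn q B t ≤ s * α' - betaFn p A s + ε) :
    dimH (localDimSet μ c α α') ≤ ENNReal.ofReal (s * α - betaFn p A s + 4 * ε) := by
  have hb := h.bounds
  have ht : 0 ≤ t := hs.trans hst
  set M := |betaFn q B t - betaFn p A t| * Real.log A with hM
  have hM0 : 0 ≤ M := mul_nonneg (abs_nonneg _) h.log_pos.le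
  have hδ : 0 < ε * Real.log B := mul_pos hε hb.log_pos
  obtain ⟨i₀, hi₀⟩ := eventually_atTop.1 (h.eventually_evenCount_le
    (show 0 < ε * Real.log B / (M + 1) by positivity))
  set η := min (ε / (t + 1)) ((-Real.log (1 - q) / Real.log B - α) / 2) with hη
  have hη0 : 0 < η := lt_min (by positivity) (by linarith)
  have hη1 : t * η ≤ ε := by
    have := mul_le_of_le_div ht hε zero_le_one (x := η)
      (by rw [mul_one]; exact min_le_left _ _)
    linarith
  have hη2 : α + η < -Real.log (1 - q) / Real.log B := by
    have : η ≤ (-Real.log (1 - q) / Real.log B - α) / 2 := min_le_right _ _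
    linarith
  have hlev : ∀ n ∈ {n | ∃ i ≥ i₀, N (2 * i) < n ∧ n ≤ N (2 * i + 1)},
      ∃ i, i₀ ≤ i ∧ N (2 * i) < n ∧ n ≤ N (2 * i + 1) := fun n hn => hn
  choose! i hi using hlev
  have huniq : ∀ n j, i₀ ≤ j → N (2 * j) < n → n ≤ N (2 * j + 1) → i n = j := by
    intro n j hj h₁ h₂
    obtain ⟨-, h₃, h₄⟩ := hi n ⟨j, hj, h₁, h₂⟩
    have := h.mono.lt_iff_lt.1 (h₁.trans_le h₄)
    have := h.mono.lt_iff_lt.1 (h₃.trans_le h₂)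
    omega
  have hsplit : ∀ n m (f : ℕ → ℝ → ℝ), m ≤ n →
      ∑ k ∈ Finset.range n, f k (if k < m then t else s) =
        ∑ k ∈ Finset.range m, f k t + (∑ k ∈ Finset.range n, f k s -
          ∑ k ∈ Finset.range m, f k s) := by
    intro n m f hmn
    rw [← Finset.sum_range_add_sum_Ico _ hmn, ← Finset.sum_range_add_sum_Ico (fun k => f k s) hmn,
      add_sub_cancel_left]
    congr 1
    · exact Finset.sum_congr rfl fun k hk => by rw [if_pos (Finset.mem_range.1 hk)]
    · exact Finset.sum_congr rfl fun k hk => by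
        rw [if_neg (not_lt.2 (Finset.mem_Ico.1 hk).1)]
  refine hb.dimH_le_of_weights (by linarith) hδ
    {n | ∃ i ≥ i₀, N (2 * i) < n ∧ n ≤ N (2 * i + 1)}
    (fun n k => if k < N (2 * i n) then t else s)
    (fun n => s * ((α + η) * logLen c n) +
      (t - s) * ((α' + η) * logLen c (N (2 * i n)))) ?_ ?_
  · rintro x ⟨hx, hlow, hup⟩
    obtain ⟨ω, hω⟩ := hb.exists_code hx
    refine ⟨ω, hω, frequently_atTop.2 fun n₀ => ?_⟩
    obtain ⟨n₁, hn₁⟩ := eventually_atTop.1 (hb.eventually_cylDim_le hμ hω hup hη0)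
    have hfreq := (hb.frequently_cylDim_le hμ hω hlow hη0).mono
      fun n hn => hb.logMass_le_of_cylDim_le hn
    obtain ⟨n, hn, ⟨j, hj₁, hj₂⟩, hle⟩ :=
      h.frequently_even hη2 hfreq (n₀ + N (2 * (n₁ + i₀) + 1) + 1)
    have hj : n₁ + i₀ ≤ j := by
      have := h.mono.lt_iff_lt.1 (show N (2 * (n₁ + i₀) + 1) < N (2 * j + 1) by omega)
      omega
    refine ⟨n, by omega, ⟨j, by omega, hj₁, hj₂⟩, ?_⟩
    rw [huniq n j (by omega) hj₁ hj₂, hsplit n _ (fun k σ => σ * cost r k (ω k)) hj₁.le]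
    simp only [← Finset.mul_sum]
    have hjN : 2 * j ≤ N (2 * j) := h.mono.le_apply
    have h₁ := hb.logMass_le_of_cylDim_le (hn₁ (N (2 * j)) (by omega))
    have h₂ := mul_le_mul_of_nonneg_left h₁ (sub_nonneg.2 hst)
    have h₃ := mul_le_mul_of_nonneg_left hle hs
    rw [logMass] at h₂ h₃
    linarith
  · intro n hn
    obtain ⟨hi₁, hi₂, hi₃⟩ := hi n hn
    have h₁ := mul_le_of_le_div hM0 hδ (Nat.cast_nonneg _) (hi₀ (i n) hi₁)
    rw [hsplit n _ (fun k σ => logPart (r (k + 1)) σ) hi₂.le, h.sum_logPart, h.sum_logPart,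
      h.sum_logPart, evenCount_of_even hi₂.le hi₃]
    have hcn := evenCount_of_even hi₂.le hi₃
    set m := N (2 * i n) with hm
    have hmn : (m : ℝ) ≤ n := Nat.cast_le.2 hi₂.le
    have h₂ : (betaFn q B t - betaFn p A t) * Real.log A * evenCount N m ≤ M * evenCount N m :=
      mul_le_mul_of_nonneg_right
        (mul_le_mul_of_nonneg_right (le_abs_self _) h.log_pos.le) (evenCount_nonneg N m)
    have hLm : 0 ≤ logLen c m :=
      (mul_nonneg m.cast_nonneg hb.log_pos.le).trans (hb.mul_log_le m)
    have hLmn : logLen c m ≤ logLen c n := hb.logLen_mono hi₂.le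
    have h₃ : betaFn p A s * (logLen c n - logLen c m) = -(logPart p s * (n - m)) := by
      rw [h.logLen_eq, h.logLen_eq, hcn, h.logPart_fst]; ring
    have h₄ : (betaFn q B t - betaFn p A t) * Real.log A * evenCount N m =
        betaFn q B t * logLen c m + (logPart p t * evenCount N m +
          logPart q t * (m - evenCount N m)) := by
      rw [h.logLen_eq, h.logPart_fst, h.logPart_snd]; ring
    have h₅ := hb.mul_log_le n
    have h₆ := mul_le_mul_of_nonneg_right hg hLm
    have h₇ : (t - s) * η * logLen c m + s * η * logLen c n ≤ ε * logLen c n := by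
      have e₁ : (t - s) * η * logLen c m ≤ (t - s) * η * logLen c n :=
        mul_le_mul_of_nonneg_left hLmn (mul_nonneg (sub_nonneg.2 hst) hη0.le)
      have e₂ := mul_le_mul_of_nonneg_right hη1 (hLm.trans hLmn)
      linarith
    have h₈ := mul_le_mul_of_nonneg_left hLmn hε.le
    have h₉ := mul_le_mul_of_nonneg_left h₅ hε.le
    have h₁₀ := mul_le_mul_of_nonneg_left hmn hδ.le
    linarith

end Moran

namespace Moran

/-- The mean of the cost of a letter under the weights proportional to `ρ ^ s`, `(1 - ρ) ^ s`. -/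
noncomputable def meanCost (ρ s : ℝ) : ℝ :=
  (ρ ^ s * -Real.log ρ + (1 - ρ) ^ s * -Real.log (1 - ρ)) / (ρ ^ s + (1 - ρ) ^ s)

variable {ρ C : ℝ}

lemma hasDerivAt_logPart (h0 : 0 < ρ) (h1 : ρ < 1) (s : ℝ) :
    HasDerivAt (logPart ρ) (-meanCost ρ s) s := by
  have e₁ := (Real.hasStrictDerivAt_const_rpow h0 s).hasDerivAt
  have e₂ := (Real.hasStrictDerivAt_const_rpow (sub_pos.2 h1) s).hasDerivAt
  have e₃ := (e₁.add e₂).log (part_pos h0 h1 s).ne'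
  refine e₃.congr_deriv ?_
  rw [meanCost, ← neg_div]
  simp only [Pi.add_apply]
  congr 1
  ring

lemma betaFn_eq (ρ C s : ℝ) : betaFn ρ C s = -logPart ρ s / Real.log C := rfl

lemma hasDerivAt_betaFn (h0 : 0 < ρ) (h1 : ρ < 1) (C s : ℝ) :
    HasDerivAt (betaFn ρ C) (meanCost ρ s / Real.log C) s := by
  have := ((hasDerivAt_logPart h0 h1 s).neg).div_const (Real.log C)
  rwa [neg_neg] at this

lemma deriv_betaFn (h0 : 0 < ρ) (h1 : ρ < 1) (C s : ℝ) :
    deriv (betaFn ρ C) s = meanCost ρ s / Real.log C :=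
  (hasDerivAt_betaFn h0 h1 C s).deriv

lemma continuous_betaFn (h0 : 0 < ρ) (h1 : ρ < 1) (C : ℝ) : Continuous (betaFn ρ C) :=
  continuous_iff_continuousAt.2 fun s => (hasDerivAt_betaFn h0 h1 C s).continuousAt

lemma continuous_meanCost (h0 : 0 < ρ) (h1 : ρ < 1) : Continuous (meanCost ρ) := by
  have e₁ : Continuous fun s : ℝ => ρ ^ s := Real.continuous_const_rpow h0.ne'
  have e₂ : Continuous fun s : ℝ => (1 - ρ) ^ s := Real.continuous_const_rpow (sub_pos.2 h1).ne'
  exact ((e₁.mul continuous_const).add (e₂.mul continuous_const)).div (e₁.add e₂)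
    fun s => (part_pos h0 h1 s).ne'

lemma logPart_tangent (h0 : 0 < ρ) (h1 : ρ < 1) (s t : ℝ) :
    logPart ρ s - meanCost ρ s * (t - s) ≤ logPart ρ t := by
  have hs := part_pos h0 h1 s
  have h1' := sub_pos.2 h1
  rw [logPart, logPart, Real.le_log_iff_exp_le (part_pos h0 h1 t), sub_eq_add_neg, Real.exp_add,
    Real.exp_log hs]
  have key := convexOn_exp.2 (mem_univ (Real.log ρ * (t - s)))
    (mem_univ (Real.log (1 - ρ) * (t - s)))
    (div_nonneg (Real.rpow_pos_of_pos h0 s).le hs.le)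
    (div_nonneg (Real.rpow_pos_of_pos h1' s).le hs.le)
    (by rw [← add_div, div_self hs.ne'])
  simp only [smul_eq_mul] at key
  rw [← Real.rpow_def_of_pos h0, ← Real.rpow_def_of_pos h1'] at key
  have e₁ : -(meanCost ρ s * (t - s)) =
      ρ ^ s / (ρ ^ s + (1 - ρ) ^ s) * (Real.log ρ * (t - s)) +
        (1 - ρ) ^ s / (ρ ^ s + (1 - ρ) ^ s) * (Real.log (1 - ρ) * (t - s)) := by
    rw [meanCost]; ring
  rw [e₁]
  refine (mul_le_mul_of_nonneg_left key hs.le).trans_eq ?_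
  have e₂ : ρ ^ t = ρ ^ s * ρ ^ (t - s) := by rw [← Real.rpow_add h0]; ring_nf
  have e₃ : (1 - ρ) ^ t = (1 - ρ) ^ s * (1 - ρ) ^ (t - s) := by
    rw [← Real.rpow_add h1']; ring_nf
  rw [e₂, e₃]
  field_simp

lemma betaFn_le_tangent (h0 : 0 < ρ) (h1 : ρ < 1) (hC : 1 < C) (s t : ℝ) :
    betaFn ρ C t ≤ betaFn ρ C s + meanCost ρ s / Real.log C * (t - s) := by
  have hl := Real.log_pos hC
  have := div_le_div_of_nonneg_right (neg_le_neg (logPart_tangent h0 h1 s t)) hl.le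
  rw [betaFn_eq, betaFn_eq]
  refine this.trans_eq ?_
  ring

lemma meanCost_antitone (h0 : 0 < ρ) (h1 : ρ < 1) : Antitone (meanCost ρ) := by
  intro s t hst
  rcases hst.eq_or_lt with rfl | hst
  · exact le_rfl
  have e₁ := logPart_tangent h0 h1 s t
  have e₂ := logPart_tangent h0 h1 t s
  have : meanCost ρ t * (t - s) ≤ meanCost ρ s * (t - s) := by linarith
  exact le_of_mul_le_mul_right this (sub_pos.2 hst)

lemma meanCost_le (h0 : 0 < ρ) (h : ρ ≤ 1 / 2) (s : ℝ) : meanCost ρ s ≤ -Real.log ρ := by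
  have h1 : ρ < 1 := by linarith
  rw [meanCost, div_le_iff₀ (part_pos h0 h1 s)]
  have := mul_le_mul_of_nonneg_left (neg_log_one_sub_le h0 h)
    (Real.rpow_pos_of_pos (sub_pos.2 h1) s).le
  linarith

lemma le_meanCost (h0 : 0 < ρ) (h : ρ ≤ 1 / 2) (s : ℝ) : -Real.log (1 - ρ) ≤ meanCost ρ s := by
  have h1 : ρ < 1 := by linarith
  rw [meanCost, le_div_iff₀ (part_pos h0 h1 s)]
  have := mul_le_mul_of_nonneg_left (neg_log_one_sub_le h0 h) (Real.rpow_pos_of_pos h0 s).le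
  linarith

lemma betaFn_zero (ρ C : ℝ) : betaFn ρ C 0 = -(Real.log 2 / Real.log C) := by
  rw [betaFn, Real.rpow_zero, Real.rpow_zero, neg_div]; norm_num

lemma betaFn_one (ρ C : ℝ) : betaFn ρ C 1 = 0 := by
  simp [betaFn]

lemma legendre_eq (h0 : 0 < ρ) (h1 : ρ < 1) (hC : 1 < C) {s α : ℝ}
    (hs : meanCost ρ s / Real.log C = α) :
    legendre (betaFn ρ C) α = s * α - betaFn ρ C s := by
  refine IsLeast.csInf_eq ⟨⟨s, rfl⟩, ?_⟩
  rintro _ ⟨t, rfl⟩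
  have := betaFn_le_tangent h0 h1 hC s t
  rw [hs] at this
  dsimp only
  linarith

/-- `s * α' - β s` is nonnegative for `s ≥ 0` when `α'` is at least the slope of `β` at
infinity. -/
lemma sub_betaFn_nonneg (h0 : 0 < ρ) (h1 : ρ < 1) (hC : 1 < C) {s α' : ℝ} (hs : 0 ≤ s)
    (hα' : -Real.log (1 - ρ) / Real.log C ≤ α') : 0 ≤ s * α' - betaFn ρ C s := by
  have hl := Real.log_pos hC
  have e₁ : s * Real.log (1 - ρ) ≤ logPart ρ s := by
    rw [logPart, Real.le_log_iff_exp_le (part_pos h0 h1 s), mul_comm,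
      ← Real.rpow_def_of_pos (sub_pos.2 h1)]
    linarith [Real.rpow_pos_of_pos h0 s]
  have e₂ : betaFn ρ C s ≤ s * (-Real.log (1 - ρ) / Real.log C) := by
    rw [betaFn_eq, ← mul_div_assoc]
    exact div_le_div_of_nonneg_right (by linarith) hl.le
  have := mul_le_mul_of_nonneg_left hα' hs
  linarith

lemma le_sub_betaFn (h0 : 0 < ρ) (h1 : ρ < 1) (hC : 1 < C) {s α' : ℝ} (hs : s ≤ 1)
    (hα' : α' ≤ meanCost ρ 1 / Real.log C) : α' ≤ s * α' - betaFn ρ C s := by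
  have := betaFn_le_tangent h0 h1 hC 1 s
  rw [betaFn_one] at this
  have := mul_le_mul_of_nonneg_right hα' (sub_nonneg.2 hs)
  linarith

lemma bddBelow_sub_betaFn (h0 : 0 < ρ) (h1 : ρ < 1) (hC : 1 < C) {α' : ℝ}
    (hα' : -Real.log (1 - ρ) / Real.log C ≤ α') (hα'1 : α' ≤ meanCost ρ 1 / Real.log C) :
    BddBelow (range fun s => s * α' - betaFn ρ C s) := by
  refine ⟨min 0 α', ?_⟩
  rintro _ ⟨s, rfl⟩
  rcases le_total 0 s with hs | hs
  · exact (min_le_left _ _).trans (sub_betaFn_nonneg h0 h1 hC hs hα')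
  · exact (min_le_right _ _).trans (le_sub_betaFn h0 h1 hC (hs.trans zero_le_one) hα'1)

lemma legendre_le (h0 : 0 < ρ) (h1 : ρ < 1) (hC : 1 < C) {α' : ℝ}
    (hα' : -Real.log (1 - ρ) / Real.log C ≤ α') (hα'1 : α' ≤ meanCost ρ 1 / Real.log C) (s : ℝ) :
    legendre (betaFn ρ C) α' ≤ s * α' - betaFn ρ C s :=
  ciInf_le (bddBelow_sub_betaFn h0 h1 hC hα' hα'1) s

/-- The infimum defining `legendre β α'` is approached on `[1, ∞)`. -/
lemma exists_one_le_lt (h0 : 0 < ρ) (h1 : ρ < 1) (hC : 1 < C) {α' : ℝ}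
    (hα'1 : α' ≤ meanCost ρ 1 / Real.log C) {ε : ℝ} (hε : 0 < ε) :
    ∃ t, 1 ≤ t ∧ t * α' - betaFn ρ C t < legendre (betaFn ρ C) α' + ε := by
  obtain ⟨t, ht⟩ := exists_lt_of_ciInf_lt
    (show ⨅ s : ℝ, (s * α' - betaFn ρ C s) < legendre (betaFn ρ C) α' + ε by
      rw [← legendre]; linarith)
  rcases le_total 1 t with h | h
  · exact ⟨t, h, ht⟩
  · refine ⟨1, le_rfl, lt_of_le_of_lt ?_ ht⟩
    rw [betaFn_one]
    linarith [le_sub_betaFn h0 h1 hC h hα'1]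

lemma tendsto_ratio_rpow (h0 : 0 < ρ) (h : ρ < 1 / 2) :
    Tendsto (fun s : ℝ => (ρ / (1 - ρ)) ^ s) atTop (𝓝 0) := by
  have h1 : 0 < 1 - ρ := by linarith
  refine tendsto_rpow_atTop_of_base_lt_one _ ?_ ((div_lt_one h1).2 (by linarith))
  linarith [div_pos h0 h1]

lemma tendsto_meanCost (h0 : 0 < ρ) (h : ρ < 1 / 2) :
    Tendsto (meanCost ρ) atTop (𝓝 (-Real.log (1 - ρ))) := by
  have h1 : 0 < 1 - ρ := by linarith
  have hlim := tendsto_ratio_rpow h0 h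
  have : meanCost ρ = fun s => ((ρ / (1 - ρ)) ^ s * -Real.log ρ + -Real.log (1 - ρ)) /
      ((ρ / (1 - ρ)) ^ s + 1) := by
    ext s
    have hs := (Real.rpow_pos_of_pos h1 s).ne'
    have hs' := (part_pos h0 (by linarith) s).ne'
    rw [meanCost, Real.div_rpow h0.le h1.le, div_add_one hs, div_mul_eq_mul_div,
      div_add' _ _ _ hs, div_div_div_cancel_right₀ hs]
    ring
  rw [this]
  have := ((hlim.mul_const (-Real.log ρ)).add_const (-Real.log (1 - ρ))).div
    (hlim.add_const 1) (by norm_num)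
  rwa [zero_mul, zero_add, zero_add, div_one] at this

lemma exists_meanCost_eq (h0 : 0 < ρ) (h : ρ < 1 / 2) {α' : ℝ}
    (hα' : -Real.log (1 - ρ) / Real.log C < α') (hα'1 : α' < meanCost ρ 1 / Real.log C) :
    ∃ s, 1 ≤ s ∧ meanCost ρ s / Real.log C = α' := by
  have hlim := (tendsto_meanCost h0 h).div_const (Real.log C)
  obtain ⟨t, ht, ht1⟩ := ((hlim.eventually_lt_const hα').and (eventually_ge_atTop 1)).exists
  obtain ⟨s, hs, hs'⟩ := intermediate_value_Icc' ht1
    ((continuous_meanCost h0 (by linarith)).div_const (Real.log C)).continuousOn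
    ⟨ht.le, hα'1.le⟩
  exact ⟨s, hs.1, hs'⟩

lemma legendre_le_zero (h0 : 0 < ρ) (h : ρ < 1 / 2) (hC : 1 < C)
    (h2 : -Real.log (1 - ρ) / Real.log C ≤ meanCost ρ 1 / Real.log C) :
    legendre (betaFn ρ C) (-Real.log (1 - ρ) / Real.log C) ≤ 0 := by
  have h1 : 0 < 1 - ρ := by linarith
  have hl := Real.log_pos hC
  have hlim := (tendsto_ratio_rpow h0 h).div_const (Real.log C)
  rw [zero_div] at hlim
  refine ge_of_tendsto' hlim fun s =>
    (legendre_le h0 (by linarith) hC le_rfl h2 s).trans ?_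
  rw [betaFn_eq, ← mul_div_assoc, ← sub_div]
  refine div_le_div_of_nonneg_right ?_ hl.le
  have hs := Real.rpow_pos_of_pos h1 s
  have hs' := Real.rpow_pos_of_pos h0 s
  have e₁ : logPart ρ s = s * Real.log (1 - ρ) + Real.log ((ρ / (1 - ρ)) ^ s + 1) := by
    rw [← Real.log_rpow h1, ← Real.log_mul hs.ne' (by positivity), logPart,
      Real.div_rpow h0.le h1.le]
    congr 1
    field_simp
  have e₂ := Real.log_le_sub_one_of_pos (show 0 < (ρ / (1 - ρ)) ^ s + 1 by positivity)
  linarith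

end Moran

namespace Moran

variable {N : ℕ → ℕ} {c r : ℕ → ℝ} {A B p q : ℝ} {μ : Measure ℝ} [IsProbabilityMeasure μ]
  {α α' : ℝ}

lemma le_ofReal_of_forall_add {x : ENNReal} {a : ℝ} (hx : ∀ ε > 0, x ≤ ENNReal.ofReal (a + ε)) :
    x ≤ ENNReal.ofReal a := by
  refine ENNReal.le_of_forall_pos_le_add fun ε hε _ => (hx ε hε).trans ?_
  refine ENNReal.ofReal_add_le.trans ?_
  rw [ENNReal.ofReal_coe_nnreal]

lemma Blocks.dimH_le_legendre_snd (h : Blocks N c r A B p q) (hμ : HasCylMass μ c r)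
    (hα'1 : -Real.log (1 - q) / Real.log B ≤ α') (hα'2 : α' < meanCost q 1 / Real.log B) :
    dimH (localDimSet μ c α α') ≤ ENNReal.ofReal (legendre (betaFn q B) α') := by
  have hB : 1 < B := by linarith [h.two_lt]
  have hq : q < 1 := by linarith [h.q_le]
  refine le_ofReal_of_forall_add fun ε hε => ?_
  obtain ⟨t, ht, hle⟩ := exists_one_le_lt h.q_pos hq hB hα'2.le (half_pos hε)
  refine (h.dimH_le_odd hμ (zero_le_one.trans ht) (half_pos hε)
    (sub_betaFn_nonneg h.q_pos hq hB (zero_le_one.trans ht) hα'1)).trans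
    (ENNReal.ofReal_le_ofReal ?_)
  linarith

lemma Blocks.dimH_le_legendre_fst (h : Blocks N c r A B p q) (hμ : HasCylMass μ c r)
    (hpq : -Real.log p / Real.log A < -Real.log (1 - q) / Real.log B)
    (hα1 : meanCost p 1 / Real.log A ≤ α) (hα2 : α ≤ meanCost p 0 / Real.log A)
    (hα'1 : -Real.log (1 - q) / Real.log B ≤ α') (hα'2 : α' < meanCost q 1 / Real.log B)
    (hnot : ¬ ∃ s₁ : ℝ, 0 ≤ s₁ ∧ s₁ ≤ 1 ∧
      legendre (betaFn q B) α' = s₁ * α' - betaFn p A s₁ ∧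
      meanCost p s₁ / Real.log A ≤ α ∧ α < meanCost p 0 / Real.log A) :
    dimH (localDimSet μ c α α') ≤ ENNReal.ofReal (legendre (betaFn p A) α) := by
  have hB : 1 < B := by linarith [h.two_lt]
  have hA : 1 < A := hB.trans h.lt
  have hp : p < 1 := by linarith [h.p_le]
  have hq : q < 1 := by linarith [h.q_le]
  have hlA := h.log_pos
  rcases hα2.eq_or_lt with heq | hα2
  · have : legendre (betaFn p A) α = Real.log 2 / Real.log A := by
      rw [legendre_eq h.p_pos hp hA heq.symm, betaFn_zero]; ring
    rw [this]
    exact le_ofReal_of_forall_add fun ε hε => h.dimH_le_even α α' hε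
  have hcont : Continuous fun s => meanCost p s / Real.log A :=
    (continuous_meanCost h.p_pos hp).div_const _
  obtain ⟨s, ⟨hs0, hs1⟩, hs⟩ := intermediate_value_Icc' zero_le_one hcont.continuousOn
    ⟨hα1, hα2.le⟩
  dsimp only at hs
  have hleg := legendre_eq h.p_pos hp hA hs
  have hg : legendre (betaFn q B) α' ≤ s * α' - betaFn p A s := by
    by_contra! hcon
    have hgc : ContinuousOn (fun t => t * α' - betaFn p A t) (Icc s 1) :=
      ((continuous_id.mul continuous_const).sub (continuous_betaFn h.p_pos hp A)).continuousOn
    have hg1 : legendre (betaFn q B) α' ≤ 1 * α' - betaFn p A 1 := by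
      have := legendre_le h.q_pos hq hB hα'1 hα'2.le 1
      rwa [betaFn_one] at this ⊢
    obtain ⟨s₁, ⟨h₁, h₂⟩, h₃⟩ := intermediate_value_Icc hs1 hgc ⟨hcon.le, hg1⟩
    refine hnot ⟨s₁, hs0.trans h₁, h₂, h₃.symm, ?_, hα2⟩
    rw [← hs]
    exact div_le_div_of_nonneg_right (meanCost_antitone h.p_pos hp h₁) hlA.le
  have hαlt : α < -Real.log (1 - q) / Real.log B :=
    (hα2.trans_le (div_le_div_of_nonneg_right (meanCost_le h.p_pos h.p_le 0) hlA.le)).trans hpq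
  have hα0 : -Real.log (1 - p) / Real.log A ≤ α := by
    rw [← hs]
    exact div_le_div_of_nonneg_right (le_meanCost h.p_pos h.p_le s) hlA.le
  rw [hleg]
  refine le_ofReal_of_forall_add fun ε hε => ?_
  obtain ⟨t, ht, hle⟩ := exists_one_le_lt h.q_pos hq hB hα'2.le (show 0 < ε / 4 by positivity)
  have := h.dimH_le_mixed hμ hs0 (hs1.trans ht) (show 0 < ε / 4 by positivity) hαlt
    (sub_betaFn_nonneg h.p_pos hp hA hs0 hα0) (hle.le.trans (by linarith))
  rwa [mul_div_cancel₀ _ four_ne_zero] at this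

theorem Blocks.dimH_le (h : Blocks N c r A B p q) (hμ : HasCylMass μ c r)
    (hpq : -Real.log p / Real.log A < -Real.log (1 - q) / Real.log B)
    (hα1 : meanCost p 1 / Real.log A ≤ α) (hα2 : α ≤ meanCost p 0 / Real.log A)
    (hα'1 : -Real.log (1 - q) / Real.log B ≤ α') (hα'2 : α' < meanCost q 1 / Real.log B)
    (hnot : ¬ ∃ s₁ : ℝ, 0 ≤ s₁ ∧ s₁ ≤ 1 ∧
      legendre (betaFn q B) α' = s₁ * α' - betaFn p A s₁ ∧
      meanCost p s₁ / Real.log A ≤ α ∧ α < meanCost p 0 / Real.log A) :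
    dimH (localDimSet μ c α α') ≤
      ENNReal.ofReal (min (legendre (betaFn p A) α) (legendre (betaFn q B) α')) := by
  rcases min_choice (legendre (betaFn p A) α) (legendre (betaFn q B) α') with hm | hm
  · rw [hm]
    exact h.dimH_le_legendre_fst hμ hpq hα1 hα2 hα'1 hα'2 hnot
  · rw [hm]
    exact h.dimH_le_legendre_snd hμ hα'1 hα'2

end Moran

namespace Moran

variable {c r : ℕ → ℝ} {A B K : ℝ}

/-- The point of the Moran set coded by `ω`. -/
noncomputable def code (c : ℕ → ℝ) (ω : ℕ → Bool) : ℝ :=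
  ∑' k, if ω k then len c k - len c (k + 1) else 0

lemma Bounds.term_nonneg (h : Bounds c r A B K) (ω : ℕ → Bool) (k : ℕ) :
    0 ≤ if ω k then len c k - len c (k + 1) else 0 := by
  split_ifs
  exacts [sub_nonneg.2 (h.len_anti (Nat.le_succ k)), le_rfl]

lemma Bounds.pos_mem_cyl (h : Bounds c r A B K) (ω : ℕ → Bool) {n m : ℕ} (hnm : n ≤ m) :
    pos c m ω ∈ cyl c n ω :=
  h.cyl_anti ω hnm ⟨le_rfl, by linarith [len_pos c m]⟩

lemma Bounds.pos_le (h : Bounds c r A B K) (ω : ℕ → Bool) (n m : ℕ) :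
    pos c m ω ≤ pos c n ω + len c n := by
  have hmono : Monotone fun n => pos c n ω := monotone_nat_of_le_succ fun n => by
    rw [pos_succ]; linarith [h.term_nonneg ω n]
  exact (hmono (le_max_right n m)).trans (h.pos_mem_cyl ω (le_max_left n m)).2

lemma Bounds.summable_code (h : Bounds c r A B K) (ω : ℕ → Bool) :
    Summable fun k => if ω k then len c k - len c (k + 1) else 0 :=
  summable_of_sum_range_le (h.term_nonneg ω) (h.pos_le ω 0)

lemma Bounds.code_mem_cyl (h : Bounds c r A B K) (ω : ℕ → Bool) (n : ℕ) :
    code c ω ∈ cyl c n ω :=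
  ⟨(h.summable_code ω).sum_le_tsum _ fun k _ => h.term_nonneg ω k,
    Real.tsum_le_of_sum_range_le (h.term_nonneg ω) (h.pos_le ω n)⟩

lemma Bounds.measurable_code (h : Bounds c r A B K) : Measurable (code c) := by
  refine measurable_of_tendsto_metrizable (f := fun n ω => pos c n ω) (fun n => ?_)
    (tendsto_pi_nhds.2 fun ω => (h.summable_code ω).hasSum.tendsto_sum_nat)
  refine Finset.measurable_sum _ fun k _ => Measurable.ite ?_ measurable_const measurable_const
  exact (measurable_pi_apply (X := fun _ : ℕ => Bool) k) (measurableSet_singleton true)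

/-- The sequences sharing the first `n` letters of `ω`. -/
def agree (n : ℕ) (ω : ℕ → Bool) : Set (ℕ → Bool) := {ω' | ∀ k < n, ω k = ω' k}

lemma Bounds.tendsto_logLen (h : Bounds c r A B K) : Tendsto (logLen c) atTop atTop :=
  tendsto_atTop_mono h.mul_log_le (tendsto_natCast_atTop_atTop.atTop_mul_const h.log_pos)

/-- Mass distribution principle on the coding space. -/
lemma Bounds.le_hausdorffMeasure (h : Bounds c r A B K) (P : Measure (ℕ → Bool))
    {d : ℝ} (hd : 0 < d) {k : ℕ} {G : Set (ℕ → Bool)}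
    (hG : ∀ ω ∈ G, ∀ n ≥ k, P (agree n ω) ≤ ENNReal.ofReal (len c n ^ d)) :
    ENNReal.ofReal (((1 - 2 / B) / A) ^ d) • (P.restrict G).map (code c) ≤ μH[d] := by
  have hg := h.gap_pos
  have hA : 0 < A := (h.ratio_pos 0).trans_le (h.ratio_le 0)
  have key : ∀ s : Set ℝ, ∀ n ≥ k, ediam s < ENNReal.ofReal ((1 - 2 / B) * len c n) →
      (P.restrict G).map (code c) s ≤ ENNReal.ofReal (len c n ^ d) := by
    intro s n hn hs
    refine (measure_mono subset_closure).trans ?_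
    rw [Measure.map_apply h.measurable_code isClosed_closure.measurableSet,
      Measure.restrict_apply (h.measurable_code isClosed_closure.measurableSet)]
    rcases (code c ⁻¹' closure s ∩ G).eq_empty_or_nonempty with he | ⟨ω, hω, hωG⟩
    · rw [he, measure_empty]; exact zero_le
    refine (measure_mono fun ω' hω' => ?_).trans (hG ω hωG n hn)
    refine h.eq_of_dist_lt (h.code_mem_cyl ω n) (h.code_mem_cyl ω' n) ?_
    have :=
      (edist_le_ediam_of_mem (s := closure s) hω hω'.1).trans_lt ((ediam_closure s).trans_lt hs)
    rwa [edist_dist, ENNReal.ofReal_lt_ofReal_iff (mul_pos hg (len_pos c n)),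
      Real.dist_eq] at this
  refine Measure.le_hausdorffMeasure d _ (ENNReal.ofReal ((1 - 2 / B) * len c (k + 1)))
    (ENNReal.ofReal_pos.2 (mul_pos hg (len_pos c _))) fun s hs => ?_
  rw [Measure.smul_apply, smul_eq_mul]
  have hlim : Tendsto (fun n => len c n ^ d) atTop (𝓝 0) := by
    have : (fun n => len c n ^ d) = fun n => Real.exp (-(d * logLen c n)) := by
      ext n; rw [len, ← Real.exp_mul]; ring_nf
    rw [this]
    exact Real.tendsto_exp_neg_atTop_nhds_zero.comp (h.tendsto_logLen.const_mul_atTop hd)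
  have hlen : Tendsto (len c) atTop (𝓝 0) :=
    Real.tendsto_exp_neg_atTop_nhds_zero.comp h.tendsto_logLen
  rcases eq_or_ne (ediam s) 0 with h0 | h0
  · have hzero : (P.restrict G).map (code c) s ≤ ENNReal.ofReal 0 := by
      refine ge_of_tendsto (ENNReal.tendsto_ofReal hlim) ?_
      filter_upwards [eventually_ge_atTop k] with n hn
      refine key s n hn ?_
      rw [h0, ENNReal.ofReal_pos]
      exact mul_pos hg (len_pos c n)
    rw [ENNReal.ofReal_zero] at hzero
    rw [le_antisymm hzero zero_le, mul_zero]
    exact zero_le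
  have hex : ∃ n, ENNReal.ofReal ((1 - 2 / B) * len c n) ≤ ediam s := by
    have := ENNReal.tendsto_ofReal (hlen.const_mul (1 - 2 / B))
    rw [mul_zero, ENNReal.ofReal_zero] at this
    exact ((this.eventually_lt_const (pos_iff_ne_zero.2 h0)).exists).imp fun n hn => hn.le
  classical
  have hfind := Nat.find_spec hex
  have hk : k < Nat.find hex := by
    by_contra! hcon
    have hlt : len c (k + 1) < len c k := by
      refine Real.exp_lt_exp.2 (neg_lt_neg ?_)
      rw [logLen_succ]; linarith [h.log_le k, h.log_pos]
    have h₁ := hfind.trans hs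
    rw [ENNReal.ofReal_le_ofReal_iff (mul_pos hg (len_pos c _)).le] at h₁
    have h₂ := le_of_mul_le_mul_left h₁ hg
    linarith [h.len_anti hcon]
  obtain ⟨j, hj⟩ : ∃ j, Nat.find hex = j + 1 := ⟨Nat.find hex - 1, by omega⟩
  have hjlt := not_le.1 (Nat.find_min hex (show j < Nat.find hex by omega))
  rw [hj] at hfind
  refine (mul_le_mul_right (key s j (by omega) hjlt) _).trans ?_
  rw [← ENNReal.ofReal_mul (Real.rpow_nonneg (div_pos hg hA).le _),
    ← Real.mul_rpow (div_pos hg hA).le (len_pos c j).le]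
  refine le_trans ?_ (ENNReal.rpow_le_rpow hfind hd.le)
  rw [ENNReal.ofReal_rpow_of_nonneg (mul_pos hg (len_pos c _)).le hd.le]
  refine ENNReal.ofReal_le_ofReal (Real.rpow_le_rpow
    (mul_pos (div_pos hg hA) (len_pos c j)).le ?_ hd.le)
  rw [h.len_succ, div_mul_eq_mul_div, mul_div_assoc]
  exact mul_le_mul_of_nonneg_left
    (div_le_div_of_nonneg_left (len_pos c j).le (h.ratio_pos j) (h.ratio_le j)) hg.le

/-- A lower bound for the Hausdorff dimension of a set carrying the image of a measure on the
coding space. -/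
lemma Bounds.le_dimH (h : Bounds c r A B K) (P : Measure (ℕ → Bool)) (hP : P ≠ 0) {d : ℝ}
    {E : Set ℝ} (hE : ∀ᵐ ω ∂P, code c ω ∈ E)
    (hdP : ∀ᵐ ω ∂P, ∀ᶠ n in atTop, P (agree n ω) ≤ ENNReal.ofReal (len c n ^ d)) :
    ENNReal.ofReal d ≤ dimH E := by
  rcases le_or_gt d 0 with hd | hd
  · rw [ENNReal.ofReal_of_nonpos hd]; exact zero_le
  set G : ℕ → Set (ℕ → Bool) := fun k =>
    {ω | ∀ n ≥ k, P (agree n ω) ≤ ENNReal.ofReal (len c n ^ d)} with hGdef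
  obtain ⟨k, hk⟩ : ∃ k, P (G k) ≠ 0 := by
    by_contra! hcon
    have h₁ : P (⋃ k, G k) = 0 := measure_iUnion_null hcon
    have h₂ : P (⋃ k, G k)ᶜ = 0 := by
      refine measure_mono_null (fun ω hω => ?_) hdP
      simp only [hGdef, mem_compl_iff, mem_iUnion, mem_ofPred_eq] at hω ⊢
      rwa [eventually_atTop]
    exact hP (Measure.measure_univ_eq_zero.1 (by
      rw [← union_compl_self (⋃ k, G k)]; exact measure_union_null h₁ h₂))
  have hA : 0 < A := (h.ratio_pos 0).trans_le (h.ratio_le 0)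
  have hle := h.le_hausdorffMeasure P hd (G := G k) (k := k) fun ω hω => hω
  have hpos : (P.restrict (G k)).map (code c) E ≠ 0 := by
    intro h0
    have h₁ := (Measure.le_restrict_apply (μ := P) (G k) (code c ⁻¹' E)).trans
      (Measure.le_map_apply h.measurable_code.aemeasurable E)
    rw [h0] at h₁
    refine hk (measure_mono_null ?_ (measure_union_null (le_antisymm h₁ zero_le) hE))
    intro ω hω
    by_cases hωE : code c ω ∈ E
    · exact Or.inl ⟨hωE, hω⟩
    · exact Or.inr hωE
  have hne : μH[d] E ≠ 0 := by
    intro h0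
    have h₁ := (hle E).trans_eq h0
    rw [Measure.smul_apply, smul_eq_mul, nonpos_iff_eq_zero, mul_eq_zero] at h₁
    refine h₁.elim (fun h₂ => ?_) hpos
    rw [ENNReal.ofReal_eq_zero] at h₂
    exact absurd (Real.rpow_pos_of_pos (div_pos h.gap_pos hA) d) (not_lt.2 h₂)
  refine le_dimH_of_hausdorffMeasure_ne_zero ?_
  rwa [Real.coe_toNNReal d hd.le]

end Moran

namespace Moran

section LawOfLargeNumbers

variable {ν : ℕ → Measure Bool} [∀ k, IsProbabilityMeasure (ν k)] {Y : ℕ → Bool → ℝ} {M : ℝ}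

lemma ae_eventually_sum_lt (hM : 0 < M) (hY : ∀ k b, |Y k b| ≤ M)
    (hzero : ∀ k, ∫ b, Y k b ∂ν k = 0) {ε : ℝ} (hε : 0 < ε) :
    ∀ᵐ ω ∂Measure.infinitePi ν, ∀ᶠ n in atTop,
      ∑ k ∈ Finset.range n, Y k (ω k) < ε * n := by
  have hind : ProbabilityTheory.iIndepFun (fun k (ω : ℕ → Bool) => Y k (ω k))
      (Measure.infinitePi ν) :=
    ProbabilityTheory.iIndepFun_infinitePi fun k => measurable_of_finite (Y k)
  set v : NNReal := (‖M - -M‖₊ / 2) ^ 2 with hv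
  have hv0 : (v : ℝ) = M ^ 2 := by
    rw [hv]; push_cast; rw [Real.norm_of_nonneg (by linarith)]; ring
  have hsub : ∀ k, ProbabilityTheory.HasSubgaussianMGF (fun ω : ℕ → Bool => Y k (ω k)) v
      (Measure.infinitePi ν) := by
    intro k
    have hmeas : Measurable fun ω : ℕ → Bool => Y k (ω k) :=
      (measurable_of_finite (Y k)).comp (measurable_pi_apply (X := fun _ : ℕ => Bool) k)
    refine ProbabilityTheory.hasSubgaussianMGF_of_mem_Icc_of_integral_eq_zero hmeas.aemeasurable
      (Eventually.of_forall fun ω => abs_le.1 (hY k (ω k))) ?_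
    have hmp := measurePreserving_eval_infinitePi ν k
    rw [← hzero k, ← hmp.map_eq, integral_map hmp.measurable.aemeasurable
      (measurable_of_finite (Y k)).aestronglyMeasurable]
  have hbound : ∀ n : ℕ, Measure.infinitePi ν {ω | ε * n ≤ ∑ k ∈ Finset.range n, Y k (ω k)} ≤
      ENNReal.ofReal (Real.exp (-(ε ^ 2 / (2 * M ^ 2))) ^ n) := by
    intro n
    have := ProbabilityTheory.HasSubgaussianMGF.measure_sum_range_ge_le_of_iIndepFun hind
      (c := v) (n := n) (fun k _ => hsub k) (show 0 ≤ ε * n by positivity)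
    rw [← ofReal_measureReal]
    refine ENNReal.ofReal_le_ofReal (this.trans_eq ?_)
    rw [← Real.exp_nat_mul, hv0]
    rcases Nat.eq_zero_or_pos n with rfl | hn
    · simp
    · congr 1
      field_simp
  have hsum : Summable fun n : ℕ => Real.exp (-(ε ^ 2 / (2 * M ^ 2))) ^ n :=
    summable_geometric_of_lt_one (Real.exp_pos _).le
      (Real.exp_lt_one_iff.2 (neg_lt_zero.2 (by positivity)))
  have hfin : ∑' n : ℕ, Measure.infinitePi ν {ω | ε * n ≤ ∑ k ∈ Finset.range n, Y k (ω k)} ≠ ⊤ :=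
    ne_top_of_le_ne_top hsum.tsum_ofReal_ne_top (ENNReal.tsum_le_tsum hbound)
  filter_upwards [ae_eventually_notMem hfin] with ω hω
  exact hω.mono fun n hn => not_le.1 hn

lemma ae_forall_eventually_abs_sum_le (hM : 0 < M) (hY : ∀ k b, |Y k b| ≤ M)
    (hzero : ∀ k, ∫ b, Y k b ∂ν k = 0) :
    ∀ᵐ ω ∂Measure.infinitePi ν, ∀ ε > 0, ∀ᶠ n : ℕ in atTop,
      |∑ k ∈ Finset.range n, Y k (ω k)| ≤ ε * n := by
  have h₁ : ∀ m : ℕ, ∀ᵐ ω ∂Measure.infinitePi ν, ∀ᶠ n in atTop,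
      ∑ k ∈ Finset.range n, Y k (ω k) < 1 / ((m : ℝ) + 1) * n := fun m =>
    ae_eventually_sum_lt hM hY hzero Nat.one_div_pos_of_nat
  have h₂ : ∀ m : ℕ, ∀ᵐ ω ∂Measure.infinitePi ν, ∀ᶠ n in atTop,
      ∑ k ∈ Finset.range n, -Y k (ω k) < 1 / ((m : ℝ) + 1) * n := fun m =>
    ae_eventually_sum_lt (Y := fun k b => -Y k b) hM (fun k b => by rw [abs_neg]; exact hY k b)
      (fun k => by rw [integral_neg, hzero, neg_zero]) Nat.one_div_pos_of_nat
  filter_upwards [ae_all_iff.2 h₁, ae_all_iff.2 h₂] with ω hω₁ hω₂ ε hε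
  obtain ⟨m, hm⟩ := exists_nat_one_div_lt hε
  filter_upwards [hω₁ m, hω₂ m] with n hn₁ hn₂
  rw [Finset.sum_neg_distrib] at hn₂
  have := mul_le_mul_of_nonneg_right hm.le (Nat.cast_nonneg (α := ℝ) n)
  exact abs_le.2 ⟨by linarith, by linarith⟩

end LawOfLargeNumbers

variable {c r : ℕ → ℝ} {A B K : ℝ}

/-- The probability of the letter `b` at position `k`, proportional to the power `σ k` of its
weight. -/
noncomputable def tiltProb (r σ : ℕ → ℝ) (k : ℕ) (b : Bool) : ℝ :=
  Real.exp (-(σ k * cost r k b + logPart (r (k + 1)) (σ k)))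

lemma tiltProb_nonneg (r σ : ℕ → ℝ) (k : ℕ) (b : Bool) : 0 ≤ tiltProb r σ k b :=
  (Real.exp_pos _).le

/-- The distribution of the letter at position `k` with probabilities `tiltProb`. -/
noncomputable def tilt (r σ : ℕ → ℝ) (k : ℕ) : Measure Bool :=
  ∑ b, ENNReal.ofReal (tiltProb r σ k b) • Measure.dirac b

lemma tilt_singleton (r σ : ℕ → ℝ) (k : ℕ) (b : Bool) :
    tilt r σ k {b} = ENNReal.ofReal (tiltProb r σ k b) := by
  cases b <;> simp [tilt]

lemma Bounds.tiltProb_eq (h : Bounds c r A B K) (σ : ℕ → ℝ) (k : ℕ) (b : Bool) :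
    tiltProb r σ k b = (if b then 1 - r (k + 1) else r (k + 1)) ^ σ k /
      (r (k + 1) ^ σ k + (1 - r (k + 1)) ^ σ k) := by
  rw [tiltProb, neg_add, Real.exp_add, Real.exp_neg (logPart _ _), logPart,
    Real.exp_log (part_pos (h.weight_pos k) (h.weight_lt_one k) _), ← h.exp_neg_cost,
    ← Real.exp_mul, div_eq_mul_inv]
  ring_nf

lemma Bounds.isProbabilityMeasure_tilt (h : Bounds c r A B K) (σ : ℕ → ℝ) (k : ℕ) :
    IsProbabilityMeasure (tilt r σ k) := by
  refine ⟨?_⟩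
  have hZ := part_pos (h.weight_pos k) (h.weight_lt_one k) (σ k)
  have : ∑ b, tiltProb r σ k b = 1 := by
    rw [Fintype.sum_bool, h.tiltProb_eq, h.tiltProb_eq]
    simp only [if_true, Bool.false_eq_true, if_false]
    rw [← add_div, add_comm, div_self hZ.ne']
  rw [tilt, Measure.finsetSum_apply]
  simp only [Measure.smul_apply, measure_univ, smul_eq_mul, mul_one]
  rw [← ENNReal.ofReal_sum_of_nonneg fun b _ => tiltProb_nonneg r σ k b, this, ENNReal.ofReal_one]

lemma Bounds.integral_tilt (h : Bounds c r A B K) (σ : ℕ → ℝ) (k : ℕ) :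
    ∫ b, (cost r k b - meanCost (r (k + 1)) (σ k)) ∂tilt r σ k = 0 := by
  have := h.isProbabilityMeasure_tilt σ k
  rw [integral_sub (Integrable.of_finite) (integrable_const _),
    integral_fintype Integrable.of_finite]
  have hreal : ∀ b, (tilt r σ k).real {b} = tiltProb r σ k b := fun b => by
    rw [Measure.real, tilt_singleton, ENNReal.toReal_ofReal (tiltProb_nonneg r σ k b)]
  simp only [hreal, Fintype.sum_bool, h.tiltProb_eq, cost, if_true, Bool.false_eq_true, if_false,
    smul_eq_mul, integral_const, probReal_univ, one_mul, meanCost]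
  ring

lemma Bounds.infinitePi_agree (h : Bounds c r A B K) (σ : ℕ → ℝ) (n : ℕ) (ω : ℕ → Bool) :
    Measure.infinitePi (tilt r σ) (agree n ω) = ENNReal.ofReal
      (Real.exp (-∑ k ∈ Finset.range n, (σ k * cost r k (ω k) + logPart (r (k + 1)) (σ k)))) := by
  have := h.isProbabilityMeasure_tilt σ
  have hset : agree n ω = (Finset.range n : Set ℕ).pi fun k => {ω k} := by
    ext ω'
    simp [agree, Set.pi, eq_comm]
  rw [hset, Measure.infinitePi_pi _ fun k _ => measurableSet_singleton _]
  simp only [tilt_singleton]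
  rw [← ENNReal.ofReal_prod_of_nonneg fun k _ => tiltProb_nonneg r σ k _, ← Finset.sum_neg_distrib,
    Real.exp_sum]
  rfl

end Moran

namespace Moran

variable {N : ℕ → ℕ} {c r : ℕ → ℝ} {A B K p q : ℝ}

lemma Bounds.cylDim_le_add (h : Bounds c r A B K) {ω : ℕ → Bool} {n : ℕ} {a ε : ℝ} (hε : 0 ≤ ε)
    (hn : 0 < n) (hle : logMass r n ω ≤ a * logLen c n + ε * Real.log B * n) :
    cylDim c r ω n ≤ a + ε := by
  rw [cylDim, div_le_iff₀ (h.logLen_pos hn)]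
  have := mul_le_mul_of_nonneg_left (h.mul_log_le n) hε
  linarith

lemma Bounds.sub_le_cylDim (h : Bounds c r A B K) {ω : ℕ → Bool} {n : ℕ} {a ε : ℝ} (hε : 0 ≤ ε)
    (hn : 0 < n) (hle : a * logLen c n - ε * Real.log B * n ≤ logMass r n ω) :
    a - ε ≤ cylDim c r ω n := by
  rw [cylDim, le_div_iff₀ (h.logLen_pos hn)]
  have := mul_le_mul_of_nonneg_left (h.mul_log_le n) hε
  linarith

/-- The local dimensions at a point along whose code the average cost is `α * log A` over the
even-indexed blocks and `α' * log B` over the odd-indexed blocks. -/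
lemma Blocks.mem_localDimSet (h : Blocks N c r A B p q) {μ : Measure ℝ} [IsProbabilityMeasure μ]
    (hμ : HasCylMass μ c r) {α α' : ℝ} (hαα' : α ≤ α') {ω : ℕ → Bool} {x : ℝ}
    (hx : ∀ n, x ∈ cyl c n ω)
    (hω : ∀ ε > 0, ∀ᶠ n : ℕ in atTop, |logMass r n ω - (α * (Real.log A * evenCount N n) +
      α' * (Real.log B * (n - evenCount N n)))| ≤ ε * n) :
    x ∈ localDimSet μ c α α' := by
  have hb := h.bounds
  have hlA := h.log_pos
  have hlB := hb.log_pos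
  have hsub := sub_nonneg.2 hαα'
  have htend : ∀ g : ℕ → ℕ, (∀ i, i ≤ g i) → Tendsto (fun i => N (g i)) atTop atTop :=
    fun g hg => tendsto_atTop_mono (fun i => (hg i).trans h.mono.le_apply) tendsto_id
  have hev := htend (fun i => 2 * i) fun i => by omega
  have hodd := htend (fun i => 2 * i + 1) fun i => by omega
  have hA0 : ∀ n, 0 ≤ (α' - α) * (Real.log A * evenCount N n) := fun n =>
    mul_nonneg hsub (mul_nonneg hlA.le (evenCount_nonneg N n))
  have hB0 : ∀ n : ℕ, 0 ≤ (α' - α) * (Real.log B * (n - evenCount N n)) := fun n =>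
    mul_nonneg hsub (mul_nonneg hlB.le (sub_nonneg.2 (evenCount_le N n)))
  refine ⟨(hb.mem_moranSet x).2 fun n => ⟨ω, hx n⟩,
    hb.lowerLocalDim_eq hμ hx (fun ε hε => ?_) (fun ε hε => ?_),
    hb.upperLocalDim_eq hμ hx (fun ε hε => ?_) (fun ε hε => ?_)⟩
  · filter_upwards [hω _ (mul_pos hε hlB), eventually_gt_atTop 0] with n hn hn0
    refine hb.sub_le_cylDim hε.le hn0 ?_
    rw [h.logLen_eq]
    linarith [(abs_le.1 hn).1, hB0 n]
  · refine hodd.frequently (Eventually.frequently ?_)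
    have hδ : 0 < ε / 2 * Real.log B := by positivity
    filter_upwards [hodd.eventually (hω _ hδ), hodd.eventually (eventually_gt_atTop 0),
      h.eventually_sub_evenCount_le
        (show 0 < ε / 2 * Real.log B / ((α' - α) * Real.log B + 1) by positivity)] with i hi hi0 hi'
    refine hb.cylDim_le_add hε.le hi0 ?_
    have := mul_le_of_le_div (by positivity) hδ (Nat.cast_nonneg _) hi'
    rw [h.logLen_eq]
    linarith [(abs_le.1 hi).2]
  · filter_upwards [hω _ (mul_pos hε hlB), eventually_gt_atTop 0] with n hn hn0
    refine hb.cylDim_le_add hε.le hn0 ?_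
    rw [h.logLen_eq]
    linarith [(abs_le.1 hn).2, hA0 n]
  · refine hev.frequently (Eventually.frequently ?_)
    have hδ : 0 < ε / 2 * Real.log B := by positivity
    filter_upwards [hev.eventually (hω _ hδ), hev.eventually (eventually_gt_atTop 0),
      h.eventually_evenCount_le
        (show 0 < ε / 2 * Real.log B / ((α' - α) * Real.log A + 1) by positivity)] with i hi hi0 hi'
    refine hb.sub_le_cylDim hε.le hi0 ?_
    have := mul_le_of_le_div (by positivity) hδ (Nat.cast_nonneg _) hi'
    rw [h.logLen_eq]
    linarith [(abs_le.1 hi).1]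

lemma Bounds.abs_cost_sub_le (h : Bounds c r A B K) (k : ℕ) (b : Bool) (m : ℝ) :
    |cost r k b - m| ≤ K + |m| := by
  refine (abs_sub _ _).trans (add_le_add_left ?_ _)
  rw [abs_of_nonneg (h.cost_nonneg k b)]
  exact h.cost_le k b

lemma Blocks.le_dimH_sub (h : Blocks N c r A B p q) {μ : Measure ℝ} [IsProbabilityMeasure μ]
    (hμ : HasCylMass μ c r) {α α' s t d : ℝ} (hαα' : α ≤ α') (hs0 : 0 ≤ s) (ht0 : 0 ≤ t)
    (hs : meanCost p s / Real.log A = α) (ht : meanCost q t / Real.log B = α')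
    (hds : d < s * α - betaFn p A s) (hdt : d < t * α' - betaFn q B t) :
    ENNReal.ofReal d ≤ dimH (localDimSet μ c α α') := by
  classical
  have hb := h.bounds
  have hlA := h.log_pos
  have hlB := hb.log_pos
  have hmA : meanCost p s = α * Real.log A := by rw [← hs, div_mul_cancel₀ _ hlA.ne']
  have hmB : meanCost q t = α' * Real.log B := by rw [← ht, div_mul_cancel₀ _ hlB.ne']
  set σ : ℕ → ℝ := fun k => if InEven N k then s else t with hσ
  have hmean : ∀ k, meanCost (r (k + 1)) (σ k) =
      if InEven N k then meanCost p s else meanCost q t := fun k => by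
    rw [h.weight_eq, hσ]; dsimp only; split_ifs <;> rfl
  set Y : ℕ → Bool → ℝ := fun k b => if InEven N k then cost r k b - meanCost p s else 0 with hY
  set Z : ℕ → Bool → ℝ := fun k b => if InEven N k then 0 else cost r k b - meanCost q t with hZ
  have hprob := hb.isProbabilityMeasure_tilt σ
  have hlaw : ∀ W : ℕ → Bool → ℝ, (∀ k, (∀ b, W k b = 0) ∨
      ∀ b, W k b = cost r k b - meanCost (r (k + 1)) (σ k)) →
      ∀ᵐ ω ∂Measure.infinitePi (tilt r σ), ∀ ε > 0, ∀ᶠ n : ℕ in atTop,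
        |∑ k ∈ Finset.range n, W k (ω k)| ≤ ε * n := by
    intro W hW
    have hK := hb.bound_nonneg
    refine ae_forall_eventually_abs_sum_le
      (M := (-Real.log p + -Real.log q) + (|meanCost p s| + |meanCost q t|) + 1)
      (by positivity) (fun k b => ?_) fun k => ?_
    · rcases hW k with hk | hk
      · rw [hk, abs_zero]; positivity
      · rw [hk]
        refine (hb.abs_cost_sub_le k b _).trans ?_
        rw [hmean]
        split_ifs <;> linarith [abs_nonneg (meanCost p s), abs_nonneg (meanCost q t)]
    · rcases hW k with hk | hk
      · simp only [hk, integral_zero]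
      · simp only [hk]; exact hb.integral_tilt σ k
  have hlawY := hlaw Y fun k => by
    by_cases hk : InEven N k
    · right; intro b; rw [hmean, if_pos hk, hY]; exact if_pos hk
    · left; intro b; exact if_neg hk
  have hlawZ := hlaw Z fun k => by
    by_cases hk : InEven N k
    · left; intro b; exact if_pos hk
    · right; intro b; rw [hmean, if_neg hk, hZ]; exact if_neg hk
  have hmass : ∀ (ω : ℕ → Bool) (n : ℕ), logMass r n ω = α * (Real.log A * evenCount N n) +
      α' * (Real.log B * (n - evenCount N n)) + ∑ k ∈ Finset.range n, Y k (ω k) +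
      ∑ k ∈ Finset.range n, Z k (ω k) := by
    intro ω n
    have : ∀ k, cost r k (ω k) = (if InEven N k then meanCost p s else meanCost q t) +
        Y k (ω k) + Z k (ω k) := fun k => by
      simp only [hY, hZ]; split_ifs <;> ring
    rw [logMass, Finset.sum_congr rfl fun k _ => this k, Finset.sum_add_distrib,
      Finset.sum_add_distrib, sum_ite_inEven, hmA, hmB]
    ring
  have hexp : ∀ (ω : ℕ → Bool) (n : ℕ), ∑ k ∈ Finset.range n,
      (σ k * cost r k (ω k) + logPart (r (k + 1)) (σ k)) =
      (s * α - betaFn p A s) * (Real.log A * evenCount N n) +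
      (t * α' - betaFn q B t) * (Real.log B * (n - evenCount N n)) +
      s * ∑ k ∈ Finset.range n, Y k (ω k) + t * ∑ k ∈ Finset.range n, Z k (ω k) := by
    intro ω n
    have : ∀ k, σ k * cost r k (ω k) + logPart (r (k + 1)) (σ k) =
        (if InEven N k then s * meanCost p s + logPart p s else t * meanCost q t + logPart q t) +
        s * Y k (ω k) + t * Z k (ω k) := fun k => by
      rw [h.weight_eq]
      simp only [hY, hZ, hσ]; split_ifs <;> ring
    rw [Finset.sum_congr rfl fun k _ => this k, Finset.sum_add_distrib,
      Finset.sum_add_distrib, sum_ite_inEven, hmA, hmB, h.logPart_fst, h.logPart_snd,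
      Finset.mul_sum, Finset.mul_sum]
    ring
  refine hb.le_dimH (Measure.infinitePi (tilt r σ)) (IsProbabilityMeasure.ne_zero _) ?_ ?_
  · filter_upwards [hlawY, hlawZ] with ω hωY hωZ
    refine h.mem_localDimSet hμ hαα' (hb.code_mem_cyl ω) fun ε hε => ?_
    filter_upwards [hωY _ (half_pos hε), hωZ _ (half_pos hε)] with n hnY hnZ
    rw [hmass, add_assoc, add_sub_cancel_left]
    refine (abs_add_le _ _).trans ?_
    linarith
  · filter_upwards [hlawY, hlawZ] with ω hωY hωZ
    set δ := min (s * α - betaFn p A s - d) (t * α' - betaFn q B t - d) with hδ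
    have hδ1 : δ ≤ s * α - betaFn p A s - d := min_le_left _ _
    have hδ2 : δ ≤ t * α' - betaFn q B t - d := min_le_right _ _
    have hδ0 : 0 < δ := lt_min (by linarith) (by linarith)
    have hε : 0 < δ * Real.log B / (s + t + 1) := by positivity
    filter_upwards [hωY _ hε, hωZ _ hε] with n hnY hnZ
    rw [hb.infinitePi_agree, len, ← Real.exp_mul, hexp]
    refine ENNReal.ofReal_le_ofReal (Real.exp_le_exp.2 ?_)
    have e₁ := mul_le_mul_of_nonneg_left (abs_le.1 hnY).1 hs0
    have e₂ := mul_le_mul_of_nonneg_left (abs_le.1 hnZ).1 ht0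
    have e₃ := mul_le_of_le_div (add_nonneg hs0 ht0) (mul_pos hδ0 hlB) (Nat.cast_nonneg n)
      (le_refl (δ * Real.log B / (s + t + 1) * (n : ℝ)))
    have e₄ := mul_le_mul_of_nonneg_left (hb.mul_log_le n) hδ0.le
    have e₅ : (d + δ) * (Real.log A * evenCount N n) ≤
        (s * α - betaFn p A s) * (Real.log A * evenCount N n) :=
      mul_le_mul_of_nonneg_right (by linarith) (mul_nonneg hlA.le (evenCount_nonneg N n))
    have e₆ : (d + δ) * (Real.log B * (n - evenCount N n)) ≤
        (t * α' - betaFn q B t) * (Real.log B * (n - evenCount N n)) :=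
      mul_le_mul_of_nonneg_right (by linarith) (mul_nonneg hlB.le (sub_nonneg.2 (evenCount_le N n)))
    rw [h.logLen_eq] at e₄ ⊢
    linarith

theorem Blocks.le_dimH (h : Blocks N c r A B p q) {μ : Measure ℝ} [IsProbabilityMeasure μ]
    (hμ : HasCylMass μ c r) {α α' : ℝ}
    (hpq : -Real.log p / Real.log A < -Real.log (1 - q) / Real.log B)
    (hα1 : meanCost p 1 / Real.log A ≤ α) (hα2 : α ≤ meanCost p 0 / Real.log A)
    (hα'1 : -Real.log (1 - q) / Real.log B ≤ α') (hα'2 : α' < meanCost q 1 / Real.log B) :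
    ENNReal.ofReal (min (legendre (betaFn p A) α) (legendre (betaFn q B) α')) ≤
      dimH (localDimSet μ c α α') := by
  have hB : 1 < B := by linarith [h.two_lt]
  have hA : 1 < A := hB.trans h.lt
  have hp : p < 1 := by linarith [h.p_le]
  have hlA := h.log_pos
  have hq : q < 1 / 2 := by
    refine lt_of_le_of_ne h.q_le fun hq => ?_
    have hhalf : Real.log (1 - q) = Real.log q := by rw [hq]; norm_num
    have := div_le_div_of_nonneg_right (meanCost_le h.q_pos h.q_le 1) h.bounds.log_pos.le
    rw [hhalf] at hα'1
    linarith
  rcases hα'1.eq_or_lt with heq | hα'1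
  · have := legendre_le_zero h.q_pos hq hB (hα'1.trans hα'2.le)
    rw [heq] at this
    rw [ENNReal.ofReal_of_nonpos ((min_le_right _ _).trans this)]
    exact zero_le
  obtain ⟨s, ⟨hs0, hs1⟩, hs⟩ := intermediate_value_Icc' zero_le_one
    ((continuous_meanCost h.p_pos hp).div_const (Real.log A)).continuousOn ⟨hα1, hα2⟩
  obtain ⟨t, ht1, ht⟩ := exists_meanCost_eq h.q_pos hq hα'1 hα'2
  have hαα' : α ≤ α' := (hα2.trans (div_le_div_of_nonneg_right
    (meanCost_le h.p_pos h.p_le 0) hlA.le)).trans (hpq.trans hα'1).le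
  rw [legendre_eq h.p_pos hp hA hs, legendre_eq h.q_pos (by linarith) hB ht]
  refine ENNReal.le_of_forall_pos_le_add fun ε hε _ => ?_
  set m := min (s * α - betaFn p A s) (t * α' - betaFn q B t) with hm
  have hε' : (0 : ℝ) < ε := hε
  have := h.le_dimH_sub hμ (d := m - ε) hαα' hs0 (zero_le_one.trans ht1) hs ht
    (by linarith [min_le_left (s * α - betaFn p A s) (t * α' - betaFn q B t)])
    (by linarith [min_le_right (s * α - betaFn p A s) (t * α' - betaFn q B t)])
  calc ENNReal.ofReal m = ENNReal.ofReal (m - ε + ε) := by rw [sub_add_cancel]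
    _ ≤ ENNReal.ofReal (m - ε) + ENNReal.ofReal ε := ENNReal.ofReal_add_le
    _ ≤ dimH (localDimSet μ c α α') + ε := by
      rw [ENNReal.ofReal_coe_nnreal]
      exact add_le_add_left this _

end Moran

/-- suppose β₁'(1) ≤ α ≤ β₁'(0) and β₂'(+∞) ≤ α' < β₂'(1), and it is NOT
the case that there exists s₁ ∈ [0,1] with β₂^*(α') = s₁·α' − β₁(s₁) and
β₁'(s₁) ≤ α < β₁'(0).  Then dim_H E(μ,α,α') = min{β₁^*(α), β₂^*(α')}. -/
theorem stmt_13 (A B p q : ℝ) (N : ℕ → ℕ)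
    (hBA : B < A) (hB2 : 2 < B)
    (hp0 : 0 < p) (hp2 : p ≤ 1 / 2) (hq0 : 0 < q) (hq2 : q ≤ 1 / 2)
    (hN0 : N 0 = 0) (hNmono : StrictMono N)
    (hNlim : Tendsto (fun i : ℕ => (N (i + 1) : ℝ) / (N i : ℝ)) atTop atTop)
    (hpq : -Real.log p / Real.log A < -Real.log (1 - q) / Real.log B)
    (c r : ℕ → ℝ)
    (hcA : ∀ i n : ℕ, N (2 * i) < n → n ≤ N (2 * i + 1) → c n = A)
    (hcB : ∀ i n : ℕ, N (2 * i + 1) < n → n ≤ N (2 * i + 2) → c n = B)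
    (hrp : ∀ i n : ℕ, N (2 * i) < n → n ≤ N (2 * i + 1) → r n = p)
    (hrq : ∀ i n : ℕ, N (2 * i + 1) < n → n ≤ N (2 * i + 2) → r n = q)
    (μ : Measure ℝ) [IsProbabilityMeasure μ]
    (hμ : ∀ w : List Bool, μ (moranI c w) = ENNReal.ofReal (cylMass r w 1 1))
    (α α' : ℝ)
    (hα1 : deriv (betaFn p A) 1 ≤ α) (hα2 : α ≤ deriv (betaFn p A) 0)
    (hα'1 : -Real.log (1 - q) / Real.log B ≤ α') (hα'2 : α' < deriv (betaFn q B) 1)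
    (hnot : ¬ ∃ s₁ : ℝ, 0 ≤ s₁ ∧ s₁ ≤ 1 ∧
      legendre (betaFn q B) α' = s₁ * α' - betaFn p A s₁ ∧
      deriv (betaFn p A) s₁ ≤ α ∧ α < deriv (betaFn p A) 0) :
    dimH {x | x ∈ moranSet c ∧ lowerLocalDim μ x = α ∧ upperLocalDim μ x = α'} =
      ENNReal.ofReal
        (min (legendre (betaFn p A) α) (legendre (betaFn q B) α')) := by
  have hp : p < 1 := by linarith
  have hq : q < 1 := by linarith
  have h : Moran.Blocks N c r A B p q :=
    ⟨hBA, hB2, hp0, hp2, hq0, hq2, hN0, hNmono, hNlim, hcA, hcB, hrp, hrq⟩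
  simp only [Moran.deriv_betaFn hp0 hp, Moran.deriv_betaFn hq0 hq] at hα1 hα2 hα'2 hnot
  exact le_antisymm (h.dimH_le hμ hpq hα1 hα2 hα'1 hα'2 hnot)
    (h.le_dimH hμ hpq hα1 hα2 hα'1 hα'2)
end

section
/- Assume 0 ≤ p_n' ≤ 1 for all n, and set x_k = −p_k' log p_k − (1−p_k') log(1−p_k). Then for ν'-almost every x ∈ Y: liminf_{n→∞} d(ν,x,n) = liminf_{n→∞} (Σ_{k=1}^n x_k)/(Σ_{k=1}^n b_k) and limsup_{n→∞} d(ν,x,n) = limsup_{n→∞} (Σ_{k=1}^n x_k)/(Σ_{k=1}^n b_k). -/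
open MeasureTheory Filter Set Metric Topology

/-- The sum along the binary word `w` of the letter values `z k`, the first letter of `w` being
read at index `n`. -/
def wordSum (z : ℕ → Bool → ℝ) : List Bool → ℕ → ℝ
  | [], _ => 0
  | bb :: w, n => z n bb + wordSum z w (n + 1)

/-- The binary words of length `n`. -/
def words : ℕ → Finset (List Bool)
  | 0 => {[]}
  | n + 1 => (words n).image (List.cons false) ∪ (words n).image (List.cons true)

lemma mem_words (w : List Bool) : w ∈ words w.length := by
  induction w with
  | nil => simp [words]
  | cons bb w ih => cases bb <;> simp [words, ih]

lemma sum_words_succ (n : ℕ) (f : List Bool → ℝ) :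
    ∑ w ∈ words (n + 1), f w =
      ∑ w ∈ words n, f (false :: w) + ∑ w ∈ words n, f (true :: w) := by
  rw [words, Finset.sum_union, Finset.sum_image (by simp), Finset.sum_image (by simp)]
  rw [Finset.disjoint_left]
  simp

lemma wordSum_const (f : ℕ → ℝ) (w : List Bool) (n : ℕ) :
    wordSum (fun k _ => f k) w n = ∑ k ∈ Finset.range w.length, f (n + k) := by
  induction w generalizing n with
  | nil => simp [wordSum]
  | cons bb w ih =>
    rw [wordSum, ih, List.length_cons, Finset.sum_range_succ', add_comm]
    simp only [add_zero]
    exact congrArg (· + f n) (Finset.sum_congr rfl fun k _ => by rw [add_assoc, add_comm 1])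

lemma wordSum_one_const (f : ℕ → ℝ) (w : List Bool) :
    wordSum (fun k _ => f k) w 1 = ∑ k ∈ Finset.Icc 1 w.length, f k := by
  rw [wordSum_const, Finset.range_eq_Ico, Finset.sum_Ico_add f 0 w.length 1]
  rfl

lemma wordSum_sub (y z : ℕ → Bool → ℝ) (w : List Bool) (n : ℕ) :
    wordSum (fun k bb => y k bb - z k bb) w n = wordSum y w n - wordSum z w n := by
  induction w generalizing n with
  | nil => simp [wordSum]
  | cons bb w ih => rw [wordSum, wordSum, wordSum, ih]; ring

lemma wordSum_neg (z : ℕ → Bool → ℝ) (w : List Bool) (n : ℕ) :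
    wordSum (fun k bb => -z k bb) w n = -wordSum z w n := by
  induction w generalizing n with
  | nil => simp [wordSum]
  | cons bb w ih => rw [wordSum, wordSum, ih]; ring

lemma cylMass_nonneg {r : ℕ → ℝ} (hr : ∀ n, 0 ≤ r n ∧ r n ≤ 1) (w : List Bool) (n : ℕ)
    {m : ℝ} (hm : 0 ≤ m) : 0 ≤ cylMass r w n m := by
  induction w generalizing n m with
  | nil => exact hm
  | cons bb w ih =>
    refine ih _ ?_
    have := hr n
    cases bb
    · simpa using mul_nonneg this.1 hm
    · simpa using mul_nonneg (sub_nonneg.2 this.2) hm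

lemma cylMass_eq_mul (r : ℕ → ℝ) (w : List Bool) (n : ℕ) (m : ℝ) :
    cylMass r w n m = m * cylMass r w n 1 := by
  induction w generalizing n m with
  | nil => simp [cylMass]
  | cons bb w ih =>
    rw [cylMass, cylMass, ih, ih _ (if bb then _ else _)]
    cases bb <;> simp <;> ring

lemma log_cylMass {r : ℕ → ℝ} (hr : ∀ n, 0 < r n ∧ r n < 1) (w : List Bool) (n : ℕ)
    {m : ℝ} (hm : 0 < m) :
    Real.log (cylMass r w n m) = Real.log m +
      wordSum (fun k bb => if bb then Real.log (1 - r k) else Real.log (r k)) w n := by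
  induction w generalizing n m with
  | nil => simp [cylMass, wordSum]
  | cons bb w ih =>
    have h0 := (hr n).1
    have h1 : 0 < 1 - r n := sub_pos.2 (hr n).2
    cases bb
    · simp only [cylMass, wordSum, Bool.false_eq_true, if_false]
      rw [ih _ (mul_pos h0 hm), Real.log_mul h0.ne' hm.ne']
      ring
    · simp only [cylMass, wordSum, if_true]
      rw [ih _ (mul_pos h1 hm), Real.log_mul h1.ne' hm.ne']
      ring

lemma log_moranCyl_snd {c : ℕ → ℝ} (hc : ∀ n, 0 < c n) (w : List Bool) (n : ℕ)
    {st : ℝ × ℝ} (hst : 0 < st.2) :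
    Real.log (moranCyl c w n st).2 =
      Real.log st.2 - wordSum (fun k _ => Real.log (c k)) w n := by
  induction w generalizing n st with
  | nil => simp [moranCyl, wordSum]
  | cons bb w ih =>
    have h := div_pos hst (hc n)
    cases bb <;>
    · simp only [moranCyl, wordSum, Bool.false_eq_true, if_false, if_true]
      rw [ih _ h, Real.log_div hst.ne' (hc n).ne']
      ring

/-- Exponential moment bound for centred letter values bounded by `M`. -/
lemma sum_cylMass_mul_exp_le {r : ℕ → ℝ} (hr : ∀ n, 0 ≤ r n ∧ r n ≤ 1) {z : ℕ → Bool → ℝ}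
    {M t : ℝ} (ht : 0 ≤ t) (htM : t * M ≤ 1) (hz : ∀ n bb, |z n bb| ≤ M)
    (hmean : ∀ n, r n * z n false + (1 - r n) * z n true = 0) (n k : ℕ) :
    ∑ w ∈ words n, cylMass r w k 1 * Real.exp (t * wordSum z w k) ≤
      Real.exp (n * (t * M) ^ 2) := by
  induction n generalizing k with
  | zero => simp [words, cylMass, wordSum]
  | succ n ih =>
    have hexp : ∀ bb, Real.exp (t * z k bb) ≤ 1 + t * z k bb + (t * M) ^ 2 := by
      intro bb
      have habs : |t * z k bb| ≤ t * M := by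
        rw [abs_mul, abs_of_nonneg ht]
        exact mul_le_mul_of_nonneg_left (hz k bb) ht
      have h1 := (abs_le.1 (Real.abs_exp_sub_one_sub_id_le (habs.trans htM))).2
      have h2 : (t * z k bb) ^ 2 ≤ (t * M) ^ 2 := sq_le_sq' (abs_le.1 habs).1 (abs_le.1 habs).2
      linarith
    have hstep : r k * Real.exp (t * z k false) + (1 - r k) * Real.exp (t * z k true) ≤
        Real.exp ((t * M) ^ 2) := by
      have h1 := mul_le_mul_of_nonneg_left (hexp false) (hr k).1
      have h2 := mul_le_mul_of_nonneg_left (hexp true) (sub_nonneg.2 (hr k).2)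
      have h3 : t * (r k * z k false + (1 - r k) * z k true) = 0 := by rw [hmean, mul_zero]
      have h4 := Real.add_one_le_exp ((t * M) ^ 2)
      linarith
    have hsplit : ∑ w ∈ words (n + 1), cylMass r w k 1 * Real.exp (t * wordSum z w k) =
        (r k * Real.exp (t * z k false) + (1 - r k) * Real.exp (t * z k true)) *
          ∑ w ∈ words n, cylMass r w (k + 1) 1 * Real.exp (t * wordSum z w (k + 1)) := by
      rw [sum_words_succ, ← Finset.sum_add_distrib, Finset.mul_sum]
      refine Finset.sum_congr rfl fun w _ => ?_
      simp only [cylMass, wordSum, Bool.false_eq_true, if_false, if_true]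
      rw [cylMass_eq_mul r w (k + 1) (r k * 1), cylMass_eq_mul r w (k + 1) ((1 - r k) * 1),
        mul_add, mul_add, Real.exp_add, Real.exp_add]
      ring
    rw [hsplit]
    refine (mul_le_mul hstep (ih (k + 1)) (Finset.sum_nonneg fun w _ =>
      mul_nonneg (cylMass_nonneg hr w _ zero_le_one) (Real.exp_pos _).le)
      (Real.exp_pos _).le).trans_eq ?_
    rw [← Real.exp_add]
    push_cast
    ring_nf

/-- Large deviation bound and Borel–Cantelli: almost every point eventually lies only in basic
intervals whose word sum is less than `ε n`. -/
lemma ae_eventually_wordSum_lt {c r : ℕ → ℝ} (hr : ∀ n, 0 ≤ r n ∧ r n ≤ 1) {μ : Measure ℝ}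
    (hμ : ∀ w : List Bool, μ (moranI c w) = ENNReal.ofReal (cylMass r w 1 1))
    {z : ℕ → Bool → ℝ} {M : ℝ} (hz : ∀ n bb, |z n bb| ≤ M)
    (hmean : ∀ n, r n * z n false + (1 - r n) * z n true = 0) {ε : ℝ} (hε : 0 < ε) :
    ∀ᵐ x ∂μ, ∀ᶠ n : ℕ in atTop, ∀ w : List Bool, w.length = n → x ∈ moranI c w →
      wordSum z w 1 < ε * n := by
  obtain ⟨t, ht, htM, htε⟩ : ∃ t : ℝ, 0 < t ∧ t * M ≤ 1 ∧ (t * M) ^ 2 ≤ t * ε / 2 := by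
    have hM : 0 ≤ M := (abs_nonneg _).trans (hz 0 true)
    refine ⟨min (1 / (M + 1)) (ε / (2 * (M + 1) ^ 2)), by positivity, ?_, ?_⟩
    · have h := min_le_left (1 / (M + 1)) (ε / (2 * (M + 1) ^ 2))
      rw [le_div_iff₀ (by positivity)] at h
      have : 0 < min (1 / (M + 1)) (ε / (2 * (M + 1) ^ 2)) := by positivity
      linarith
    · have h := min_le_right (1 / (M + 1)) (ε / (2 * (M + 1) ^ 2))
      rw [le_div_iff₀ (by positivity)] at h
      have ht : 0 < min (1 / (M + 1)) (ε / (2 * (M + 1) ^ 2)) := by positivity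
      set t := min (1 / (M + 1)) (ε / (2 * (M + 1) ^ 2))
      have h1 : t * M ^ 2 ≤ t * (M + 1) ^ 2 := by gcongr; linarith
      have h2 : t * (t * M ^ 2) ≤ t * (ε / 2) := mul_le_mul_of_nonneg_left (by linarith) ht.le
      linarith
  set E : ℕ → Set ℝ := fun n =>
    ⋃ w ∈ (words n).filter (fun w => ε * n ≤ wordSum z w 1), moranI c w with hE
  have hbound : ∀ n, μ (E n) ≤ ENNReal.ofReal (Real.exp (-(t * ε / 2)) ^ n) := by
    intro n
    calc μ (E n)
        ≤ ∑ w ∈ (words n).filter (fun w => ε * n ≤ wordSum z w 1), μ (moranI c w) :=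
          measure_biUnion_finset_le _ _
      _ = ENNReal.ofReal (∑ w ∈ (words n).filter (fun w => ε * n ≤ wordSum z w 1),
            cylMass r w 1 1) := by
          rw [ENNReal.ofReal_sum_of_nonneg fun w _ => cylMass_nonneg hr w 1 zero_le_one]
          exact Finset.sum_congr rfl fun w _ => hμ w
      _ ≤ ENNReal.ofReal (Real.exp (-(t * ε / 2)) ^ n) := by
          refine ENNReal.ofReal_le_ofReal ?_
          have hnn : ∀ w, 0 ≤ cylMass r w 1 1 := fun w => cylMass_nonneg hr w 1 zero_le_one
          calc ∑ w ∈ (words n).filter (fun w => ε * n ≤ wordSum z w 1), cylMass r w 1 1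
              ≤ ∑ w ∈ (words n).filter (fun w => ε * n ≤ wordSum z w 1),
                  Real.exp (-(t * (ε * n))) *
                    (cylMass r w 1 1 * Real.exp (t * wordSum z w 1)) := by
                refine Finset.sum_le_sum fun w hw => ?_
                have h1 : 1 ≤ Real.exp (-(t * (ε * n)) + t * wordSum z w 1) := by
                  refine Real.one_le_exp ?_
                  have := mul_le_mul_of_nonneg_left (Finset.mem_filter.1 hw).2 ht.le
                  linarith
                rw [Real.exp_add] at h1
                nlinarith [mul_le_mul_of_nonneg_left h1 (hnn w)]
            _ ≤ ∑ w ∈ words n, Real.exp (-(t * (ε * n))) *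
                    (cylMass r w 1 1 * Real.exp (t * wordSum z w 1)) :=
                Finset.sum_le_sum_of_subset_of_nonneg (Finset.filter_subset _ _) fun w _ _ =>
                  mul_nonneg (Real.exp_pos _).le (mul_nonneg (hnn w) (Real.exp_pos _).le)
            _ ≤ Real.exp (-(t * (ε * n))) * Real.exp (n * (t * M) ^ 2) := by
                rw [← Finset.mul_sum]
                exact mul_le_mul_of_nonneg_left
                  (sum_cylMass_mul_exp_le hr ht.le htM hz hmean n 1) (Real.exp_pos _).le
            _ ≤ Real.exp (-(t * ε / 2)) ^ n := by
                rw [← Real.exp_add, ← Real.exp_nat_mul]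
                refine Real.exp_le_exp.2 ?_
                have := mul_le_mul_of_nonneg_left htε (Nat.cast_nonneg (α := ℝ) n)
                linarith
  have hsum : ∑' n, μ (E n) ≠ ⊤ := by
    refine ne_top_of_le_ne_top ?_ (ENNReal.tsum_le_tsum hbound)
    refine (summable_geometric_of_lt_one (Real.exp_pos _).le ?_).tsum_ofReal_ne_top
    rw [Real.exp_lt_one_iff]
    have := mul_pos ht hε
    linarith
  filter_upwards [ae_eventually_notMem hsum] with x hx
  filter_upwards [hx] with n hn w hw hxw
  by_contra! hle
  subst hw
  exact hn (mem_iUnion₂.2 ⟨w, Finset.mem_filter.2 ⟨mem_words w, hle⟩, hxw⟩)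

/-- Strong law of large numbers for centred bounded letter values. -/
lemma ae_tendsto_wordSum_div {c r : ℕ → ℝ} (hr : ∀ n, 0 ≤ r n ∧ r n ≤ 1) {μ : Measure ℝ}
    (hμ : ∀ w : List Bool, μ (moranI c w) = ENNReal.ofReal (cylMass r w 1 1))
    {z : ℕ → Bool → ℝ} {M : ℝ} (hz : ∀ n bb, |z n bb| ≤ M)
    (hmean : ∀ n, r n * z n false + (1 - r n) * z n true = 0) :
    ∀ᵐ x ∂μ, ∀ W : ℕ → List Bool, (∀ n, (W n).length = n ∧ x ∈ moranI c (W n)) →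
      Tendsto (fun n : ℕ => wordSum z (W n) 1 / n) atTop (𝓝 0) := by
  have hpos : ∀ j : ℕ, 0 < 1 / ((j : ℝ) + 1) := fun j => Nat.one_div_pos_of_nat
  have h1 := ae_all_iff.2 fun j : ℕ => ae_eventually_wordSum_lt hr hμ hz hmean (hpos j)
  have h2 := ae_all_iff.2 fun j : ℕ => ae_eventually_wordSum_lt hr hμ
    (z := fun k bb => -z k bb) (M := M) (fun n bb => by rw [abs_neg]; exact hz n bb)
    (fun n => by linarith [hmean n]) (hpos j)
  filter_upwards [h1, h2] with x hx1 hx2 W hW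
  rw [Metric.tendsto_atTop']
  intro ε hε
  obtain ⟨j, hj⟩ := exists_nat_one_div_lt hε
  have hev : ∀ᶠ n : ℕ in atTop, dist (wordSum z (W n) 1 / n) 0 < ε := by
    filter_upwards [hx1 j, hx2 j, eventually_gt_atTop 0] with n hn1 hn2 hn
    have hn' : (0 : ℝ) < n := Nat.cast_pos.2 hn
    have hu := hn1 (W n) (hW n).1 (hW n).2
    have hl := hn2 (W n) (hW n).1 (hW n).2
    rw [wordSum_neg] at hl
    rw [Real.dist_eq, sub_zero, abs_div, abs_of_pos hn', div_lt_iff₀ hn']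
    have hjn := mul_lt_mul_of_pos_right hj hn'
    exact abs_lt.2 ⟨by linarith, by linarith⟩
  obtain ⟨N, hN⟩ := eventually_atTop.1 hev
  exact ⟨N, fun n hn => hN n hn.le⟩

/-- Two real sequences, one of them bounded, whose difference tends to `0` have the same lower and
upper limits. -/
lemma liminf_eq_and_limsup_eq_of_tendsto_sub {f g : ℕ → ℝ} {C : ℝ} (hg : ∀ n, |g n| ≤ C)
    (h : Tendsto (fun n => f n - g n) atTop (𝓝 0)) :
    liminf f atTop = liminf g atTop ∧ limsup f atTop = limsup g atTop := by
  have hf : f = g + fun n => f n - g n := by ext n; simp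
  have hf' : f = (fun n => f n - g n) + g := by ext n; simp
  have gle : IsBoundedUnder (· ≤ ·) atTop g := isBoundedUnder_of ⟨C, fun n => (abs_le.1 (hg n)).2⟩
  have gge : IsBoundedUnder (· ≥ ·) atTop g := isBoundedUnder_of ⟨-C, fun n => (abs_le.1 (hg n)).1⟩
  have hle := h.isBoundedUnder_le
  have hge := h.isBoundedUnder_ge
  have e1 := le_liminf_add gge gle hge hle.isCoboundedUnder_ge
  have e2 := liminf_add_le hge hle gge gle.isCoboundedUnder_ge
  have e3 := limsup_add_le gge gle hge.isCoboundedUnder_le hle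
  have e4 := le_limsup_add gle gge.isCoboundedUnder_le hle hge
  rw [← hf, h.liminf_eq, add_zero] at e1
  rw [← hf', h.limsup_eq, zero_add] at e2
  rw [← hf, h.limsup_eq, add_zero] at e3
  rw [← hf, h.liminf_eq, add_zero] at e4
  exact ⟨le_antisymm e2 e1, le_antisymm e3 e4⟩

/-- with x_k = −p'_k log p_k − (1−p'_k) log(1−p_k) and b_k = log A_k,
for ν'-almost every x ∈ Y, the liminf and limsup of d(ν,x,n) = log ν(I_n(x))/log |I_n(x)|
coincide with those of (Σ_{k=1}^n x_k)/(Σ_{k=1}^n b_k). -/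
theorem stmt_14 (A : ℕ → ℝ) (a b : ℝ) (p p' : ℕ → ℝ)
    (hA : ∀ n : ℕ, 2 ≤ A n)
    (ha0 : 0 < a) (hab : a ≤ b) (hb1 : b < 1)
    (hp : ∀ n : ℕ, a ≤ p n ∧ p n ≤ b)
    (hp' : ∀ n : ℕ, 0 ≤ p' n ∧ p' n ≤ 1)
    (ν ν' : Measure ℝ) [IsProbabilityMeasure ν] [IsProbabilityMeasure ν']
    (hν : ∀ w : List Bool, ν (moranI A w) = ENNReal.ofReal (cylMass p w 1 1))
    (hν' : ∀ w : List Bool, ν' (moranI A w) = ENNReal.ofReal (cylMass p' w 1 1)) :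
    ∀ᵐ x ∂ν', ∀ W : ℕ → List Bool,
      (∀ n : ℕ, (W n).length = n ∧ x ∈ moranI A (W n)) →
      liminf (fun n : ℕ =>
          Real.log (ν (moranI A (W n))).toReal / Real.log (moranLen A (W n))) atTop =
        liminf (fun n : ℕ =>
          (∑ k ∈ Finset.Icc 1 n,
            (-(p' k * Real.log (p k)) - (1 - p' k) * Real.log (1 - p k))) /
          (∑ k ∈ Finset.Icc 1 n, Real.log (A k))) atTop ∧
      limsup (fun n : ℕ =>
          Real.log (ν (moranI A (W n))).toReal / Real.log (moranLen A (W n))) atTop =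
        limsup (fun n : ℕ =>
          (∑ k ∈ Finset.Icc 1 n,
            (-(p' k * Real.log (p k)) - (1 - p' k) * Real.log (1 - p k))) /
          (∑ k ∈ Finset.Icc 1 n, Real.log (A k))) atTop := by
  set x : ℕ → ℝ := fun k => -(p' k * Real.log (p k)) - (1 - p' k) * Real.log (1 - p k) with hx
  set y : ℕ → Bool → ℝ := fun k bb => if bb then Real.log (1 - p k) else Real.log (p k) with hy
  set M : ℝ := -Real.log a - Real.log (1 - b) with hM
  have hp1 : ∀ n, 0 < p n ∧ p n < 1 := fun n => ⟨ha0.trans_le (hp n).1, (hp n).2.trans_lt hb1⟩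
  have hyM : ∀ k bb, y k bb ≤ 0 ∧ -M ≤ y k bb := by
    intro k bb
    have h1 := Real.log_le_log ha0 (hp k).1
    have h2 := Real.log_le_log (sub_pos.2 hb1) (sub_le_sub_left (hp k).2 1)
    have h3 := Real.log_nonpos (hp1 k).1.le (hp1 k).2.le
    have h4 := Real.log_nonpos (sub_pos.2 (hp1 k).2).le (sub_le_self 1 (hp1 k).1.le)
    cases bb <;> simp only [hy, Bool.false_eq_true, if_false, if_true] <;>
      constructor <;> linarith
  have hx_eq : ∀ k, x k = -(p' k * y k false) - (1 - p' k) * y k true := fun k => by simp [hx, hy]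
  have hxM : ∀ k, 0 ≤ x k ∧ x k ≤ M := by
    intro k
    have h0 := (hp' k).1
    have h1 := sub_nonneg.2 (hp' k).2
    obtain ⟨f0, fM⟩ := hyM k false
    obtain ⟨t0, tM⟩ := hyM k true
    rw [hx_eq]
    constructor <;> nlinarith
  have hlog : ∀ k, Real.log 2 ≤ Real.log (A k) := fun k => Real.log_le_log two_pos (hA k)
  have hlog2 : 0 < Real.log 2 := Real.log_pos one_lt_two
  have hB : ∀ n : ℕ, n * Real.log 2 ≤ ∑ k ∈ Finset.Icc 1 n, Real.log (A k) := by
    intro n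
    simpa using Finset.card_nsmul_le_sum (Finset.Icc 1 n) _ _ fun k _ => hlog k
  have hX : ∀ n : ℕ, ∑ k ∈ Finset.Icc 1 n, x k ≤ n * M := by
    intro n
    simpa using Finset.sum_le_card_nsmul (Finset.Icc 1 n) _ _ fun k _ => (hxM k).2
  have hX0 : ∀ n : ℕ, 0 ≤ ∑ k ∈ Finset.Icc 1 n, x k := fun n => Finset.sum_nonneg fun k _ => (hxM k).1
  have hM0 : 0 ≤ M := (hxM 0).1.trans (hxM 0).2
  have hslln := ae_tendsto_wordSum_div hp' hν' (z := fun k bb => y k bb - -x k) (M := M)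
    (fun k bb => abs_le.2 ⟨by linarith [(hyM k bb).2, (hxM k).1],
      by linarith [(hyM k bb).1, (hxM k).2]⟩)
    (fun k => by rw [hx_eq]; ring)
  filter_upwards [hslln] with ξ hξ W hW
  refine liminf_eq_and_limsup_eq_of_tendsto_sub (C := M / Real.log 2) ?_ ?_
  · intro n
    rcases n.eq_zero_or_pos with rfl | hn
    · simpa using by positivity
    have hn' : (0 : ℝ) < n := Nat.cast_pos.2 hn
    have hBn : 0 < ∑ k ∈ Finset.Icc 1 n, Real.log (A k) := (mul_pos hn' hlog2).trans_le (hB n)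
    rw [abs_of_nonneg (div_nonneg (hX0 n) hBn.le), div_le_div_iff₀ hBn hlog2]
    nlinarith [hX n, mul_le_mul_of_nonneg_left (hB n) hM0]
  · refine squeeze_zero_norm (a := fun n : ℕ =>
      |wordSum (fun k bb => y k bb - -x k) (W n) 1 / n| * (Real.log 2)⁻¹) (fun n => ?_) ?_
    · rw [hν, moranLen, log_moranCyl_snd (fun n => two_pos.trans_le (hA n)) _ _ one_pos,
        ENNReal.toReal_ofReal (cylMass_nonneg (fun n => ⟨(hp1 n).1.le, (hp1 n).2.le⟩) _ _
          zero_le_one), log_cylMass hp1 _ _ one_pos, wordSum_one_const, (hW n).1,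
        wordSum_sub, wordSum_one_const (fun k => -x k), (hW n).1, Finset.sum_neg_distrib]
      simp only [Real.log_one, zero_add, zero_sub, sub_neg_eq_add]
      rw [div_neg, ← neg_div, ← sub_div, Real.norm_eq_abs, abs_div, abs_div, Nat.abs_cast,
        ← neg_add', abs_neg, div_mul_eq_mul_div, ← div_eq_mul_inv, div_div, mul_comm (Real.log 2)]
      rcases n.eq_zero_or_pos with rfl | hn
      · simp
      have hn' : (0 : ℝ) < n := Nat.cast_pos.2 hn
      exact div_le_div_of_nonneg_left (abs_nonneg _) (mul_pos hn' hlog2)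
        ((hB n).trans (le_abs_self _))
    · simpa using (hξ W hW).abs.mul_const (Real.log 2)⁻¹
end

section
/- Assume 2 < Ā_ := inf_n A_n and Ā := sup_n A_n < ∞. Let x ∈ Y and r > 0. (i) If n ≥ 1 satisfies I_n(x) ⊆ B(x,r) and I_{n−1}(x) ⊄ B(x,r), then r/Ā ≤ r/A_n ≤ |I_n(x)| ≤ 2r. (ii) If n' ≥ 0 satisfies B(x,r) ∩ Y ⊆ I_{n'}(x) and B(x,r) ∩ Y ⊄ I_{n'+1}(x), then |I_{n'}(x)| ≤ 2·A_{n'+1}·r/(A_{n'+1} − 2) ≤ 2·Ā_·r/(Ā_ − 2). Here B(x,r) denotes the closed ball of radius r about x. -/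
open MeasureTheory Filter Set Metric Topology

/-- The left endpoint of the basic interval `I_w`. -/
noncomputable def moranLeft (c : ℕ → ℝ) (w : List Bool) : ℝ :=
  (moranCyl c w 1 (0, 1)).1

theorem moranCyl_append (c : ℕ → ℝ) (u v : List Bool) (n : ℕ) (st : ℝ × ℝ) :
    moranCyl c (u ++ v) n st = moranCyl c v (n + u.length) (moranCyl c u n st) := by
  induction u generalizing n st with
  | nil => rfl
  | cons d u ih =>
    simp only [List.cons_append, moranCyl, ih, List.length_cons]
    congr 1
    omega

theorem moranLen_concat (c : ℕ → ℝ) (w : List Bool) (d : Bool) :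
    moranLen c (w ++ [d]) = moranLen c w / c (w.length + 1) := by
  cases d <;> simp [moranLen, moranCyl_append, moranCyl, add_comm]

theorem moranLeft_concat_false (c : ℕ → ℝ) (w : List Bool) :
    moranLeft c (w ++ [false]) = moranLeft c w := by
  simp [moranLeft, moranCyl_append, moranCyl]

theorem moranLeft_concat_true (c : ℕ → ℝ) (w : List Bool) :
    moranLeft c (w ++ [true]) =
      moranLeft c w + moranLen c w - moranLen c w / c (w.length + 1) := by
  simp [moranLeft, moranLen, moranCyl_append, moranCyl, add_comm]

theorem mem_moranI {c : ℕ → ℝ} {w : List Bool} {x : ℝ} :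
    x ∈ moranI c w ↔ moranLeft c w ≤ x ∧ x ≤ moranLeft c w + moranLen c w :=
  Iff.rfl

theorem mem_moranI_concat_false {c : ℕ → ℝ} {w : List Bool} {x : ℝ} :
    x ∈ moranI c (w ++ [false]) ↔
      moranLeft c w ≤ x ∧ x ≤ moranLeft c w + moranLen c w / c (w.length + 1) := by
  rw [mem_moranI, moranLeft_concat_false, moranLen_concat]

theorem mem_moranI_concat_true {c : ℕ → ℝ} {w : List Bool} {x : ℝ} :
    x ∈ moranI c (w ++ [true]) ↔
      moranLeft c w + moranLen c w - moranLen c w / c (w.length + 1) ≤ x ∧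
        x ≤ moranLeft c w + moranLen c w := by
  rw [mem_moranI, moranLeft_concat_true, moranLen_concat, sub_add_cancel]

theorem moranLen_pos {c : ℕ → ℝ} (hc : ∀ n, 0 < c n) (w : List Bool) : 0 < moranLen c w := by
  induction w using List.reverseRecOn with
  | nil => simp [moranLen, moranCyl]
  | append_singleton w d ih =>
    rw [moranLen_concat]
    exact div_pos ih (hc _)

theorem moranI_concat_subset {c : ℕ → ℝ} (hc : ∀ n, 1 ≤ c n) (w : List Bool) (d : Bool) :
    moranI c (w ++ [d]) ⊆ moranI c w := by
  intro x hx
  have hle : moranLen c w / c (w.length + 1) ≤ moranLen c w :=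
    div_le_self (moranLen_pos (fun n => one_pos.trans_le (hc n)) w).le (hc _)
  rw [mem_moranI]
  cases d
  · rw [mem_moranI_concat_false] at hx
    constructor <;> linarith
  · rw [mem_moranI_concat_true] at hx
    constructor <;> linarith

theorem abs_sub_le_moranLen {c : ℕ → ℝ} {w : List Bool} {x y : ℝ}
    (hx : x ∈ moranI c w) (hy : y ∈ moranI c w) : |x - y| ≤ moranLen c w := by
  rw [mem_moranI] at hx hy
  rw [abs_le]
  constructor <;> linarith

theorem moranGap_le_abs_sub {c : ℕ → ℝ} {w : List Bool} {d e : Bool} (hde : d ≠ e) {x y : ℝ}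
    (hx : x ∈ moranI c (w ++ [d])) (hy : y ∈ moranI c (w ++ [e])) :
    moranLen c w - 2 * (moranLen c w / c (w.length + 1)) ≤ |x - y| := by
  cases d <;> cases e <;> first | exact absurd rfl hde | skip
  · rw [mem_moranI_concat_false] at hx
    rw [mem_moranI_concat_true] at hy
    rw [abs_sub_comm]
    exact le_trans (by linarith) (le_abs_self _)
  · rw [mem_moranI_concat_true] at hx
    rw [mem_moranI_concat_false] at hy
    exact le_trans (by linarith) (le_abs_self _)

theorem eq_of_mem_moranI {c : ℕ → ℝ} (hc : ∀ n, 2 < c n) {u v : List Bool}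
    (huv : u.length = v.length) {x : ℝ} (hu : x ∈ moranI c u) (hv : x ∈ moranI c v) :
    u = v := by
  have hc1 : ∀ n, 1 ≤ c n := fun n => by linarith [hc n]
  induction u using List.reverseRecOn generalizing v with
  | nil => exact (List.length_eq_zero_iff.mp huv.symm).symm
  | append_singleton u d ih =>
    obtain rfl | ⟨v, e, rfl⟩ := v.eq_nil_or_concat'
    · simp at huv
    obtain rfl : u = v := ih (by simpa using huv)
      (moranI_concat_subset hc1 u d hu) (moranI_concat_subset hc1 v e hv)
    by_contra hne
    have hgap := moranGap_le_abs_sub (fun h : d = e => hne (by rw [h])) hu hv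
    have hlen := moranLen_pos (fun n => two_pos.trans (hc n)) u
    have : moranLen c u / c (u.length + 1) < moranLen c u / 2 :=
      div_lt_div_of_pos_left hlen two_pos (hc _)
    rw [sub_self, abs_zero] at hgap
    linarith

theorem exists_mem_moranI_of_mem_moranSet {c : ℕ → ℝ} {x : ℝ} (hx : x ∈ moranSet c) (n : ℕ) :
    ∃ w : List Bool, w.length = n ∧ x ∈ moranI c w := by
  simpa [moranSet] using mem_iInter.mp hx n

theorem exists_mem_moranI_concat {c : ℕ → ℝ} (hc : ∀ n, 2 < c n) {w : List Bool} {x : ℝ}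
    (hx : x ∈ moranSet c) (hw : x ∈ moranI c w) : ∃ d, x ∈ moranI c (w ++ [d]) := by
  obtain ⟨v, hv, hxv⟩ := exists_mem_moranI_of_mem_moranSet hx (w.length + 1)
  obtain rfl | ⟨v, d, rfl⟩ := v.eq_nil_or_concat'
  · simp at hv
  obtain rfl : v = w := eq_of_mem_moranI hc (by simpa using hv)
    (moranI_concat_subset (fun n => by linarith [hc n]) v d hxv) hw
  exact ⟨d, hxv⟩

theorem moranLen_le_of_moranI_subset_closedBall {c : ℕ → ℝ} (hc : ∀ n, 0 < c n)
    {w : List Bool} {x r : ℝ} (h : moranI c w ⊆ closedBall x r) : moranLen c w ≤ 2 * r := by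
  have hlen := moranLen_pos hc w
  have hl : moranLeft c w ∈ closedBall x r :=
    h (mem_moranI.mpr ⟨le_rfl, by linarith⟩)
  have hu : moranLeft c w + moranLen c w ∈ closedBall x r :=
    h (mem_moranI.mpr ⟨by linarith, le_rfl⟩)
  rw [mem_closedBall, Real.dist_eq, abs_le] at hl hu
  linarith

theorem lt_moranLen_of_not_subset_closedBall {c : ℕ → ℝ} {w : List Bool} {x r : ℝ}
    (hx : x ∈ moranI c w) (h : ¬ moranI c w ⊆ closedBall x r) : r < moranLen c w := by
  obtain ⟨z, hz, hzr⟩ := not_subset.mp h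
  rw [mem_closedBall, Real.dist_eq, not_le] at hzr
  exact hzr.trans_le (abs_sub_le_moranLen hz hx)

theorem moranLen_le_of_not_subset_moranI_concat {c : ℕ → ℝ} (hc : ∀ n, 2 < c n)
    {w : List Bool} {d : Bool} {x r : ℝ} (hxd : x ∈ moranI c (w ++ [d]))
    (hsub : closedBall x r ∩ moranSet c ⊆ moranI c w)
    (hnot : ¬ closedBall x r ∩ moranSet c ⊆ moranI c (w ++ [d])) :
    moranLen c w ≤ c (w.length + 1) * r / (c (w.length + 1) - 2) := by
  obtain ⟨y, hy, hyd⟩ := not_subset.mp hnot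
  obtain ⟨e, hye⟩ := exists_mem_moranI_concat hc hy.2 (hsub hy)
  have hgap := moranGap_le_abs_sub (fun h : e = d => hyd (h ▸ hye)) hye hxd
  have hyr := hy.1
  rw [mem_closedBall, Real.dist_eq] at hyr
  have hC := hc (w.length + 1)
  have hC0 : 0 < c (w.length + 1) := by linarith
  rw [le_div_iff₀ (by linarith)]
  calc moranLen c w * (c (w.length + 1) - 2)
      = c (w.length + 1) * (moranLen c w - 2 * (moranLen c w / c (w.length + 1))) := by
        field_simp
    _ ≤ c (w.length + 1) * r := by gcongr; exact hgap.trans hyr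

theorem antitoneOn_two_mul_mul_div_sub_two {r : ℝ} (hr : 0 ≤ r) :
    AntitoneOn (fun t : ℝ => 2 * t * r / (t - 2)) (Ioi 2) := by
  intro s hs t ht hst
  rw [mem_Ioi] at hs ht
  change 2 * t * r / (t - 2) ≤ 2 * s * r / (s - 2)
  rw [div_le_div_iff₀ (by linarith) (by linarith)]
  nlinarith [mul_nonneg hr (sub_nonneg.mpr hst)]

/-- assume 2 < inf_n A_n and sup_n A_n < ∞, let x ∈ Y and r > 0.
(i) If a level-n interval I_n(x) ∋ x (here I_n(x) = I_W with |W| = n, and I_{n-1}(x) its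
level-(n−1) ancestor I_{W.take (n-1)}) satisfies I_n(x) ⊆ B(x,r) and I_{n−1}(x) ⊄ B(x,r),
then r/sup A ≤ r/A_n ≤ |I_n(x)| ≤ 2r.
(ii) If a level-n' interval I_{n'}(x) ∋ x satisfies B(x,r) ∩ Y ⊆ I_{n'}(x) while no
level-(n'+1) interval containing x contains B(x,r) ∩ Y, then
|I_{n'}(x)| ≤ 2·A_{n'+1}·r/(A_{n'+1} − 2) ≤ 2·(inf A)·r/((inf A) − 2). -/
theorem stmt_16 (A : ℕ → ℝ) (a b : ℝ) (p p' : ℕ → ℝ)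
    (hA : ∀ n : ℕ, 2 ≤ A n)
    (ha0 : 0 < a) (hab : a ≤ b) (hb1 : b < 1)
    (hp : ∀ n : ℕ, a ≤ p n ∧ p n ≤ b)
    (hp' : ∀ n : ℕ, a ≤ p' n ∧ p' n ≤ b)
    (hinf : 2 < ⨅ n : ℕ, A n) (hbdd : BddAbove (Set.range A))
    (x : ℝ) (hx : x ∈ moranSet A) (r : ℝ) (hr : 0 < r) :
    (∀ (n : ℕ) (W : List Bool), 1 ≤ n → W.length = n → x ∈ moranI A W →
        moranI A W ⊆ closedBall x r →
        ¬ moranI A (W.take (n - 1)) ⊆ closedBall x r →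
        r / (⨆ m : ℕ, A m) ≤ r / A n ∧ r / A n ≤ moranLen A W ∧
          moranLen A W ≤ 2 * r) ∧
    (∀ (n' : ℕ) (W : List Bool), W.length = n' → x ∈ moranI A W →
        closedBall x r ∩ moranSet A ⊆ moranI A W →
        (∀ W' : List Bool, W'.length = n' + 1 → x ∈ moranI A W' →
          ¬ closedBall x r ∩ moranSet A ⊆ moranI A W') →
        moranLen A W ≤ 2 * A (n' + 1) * r / (A (n' + 1) - 2) ∧
          2 * A (n' + 1) * r / (A (n' + 1) - 2) ≤
            2 * (⨅ m : ℕ, A m) * r / ((⨅ m : ℕ, A m) - 2)) := by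
  have hlow : BddBelow (Set.range A) := ⟨2, by rintro _ ⟨n, rfl⟩; exact hA n⟩
  have hA2 : ∀ n, 2 < A n := fun n => hinf.trans_le (ciInf_le hlow n)
  have hA0 : ∀ n, 0 < A n := fun n => by linarith [hA2 n]
  have hA1 : ∀ n, 1 ≤ A n := fun n => by linarith [hA2 n]
  refine ⟨fun n W hn hW hxW hsub hnot => ⟨?_, ?_, ?_⟩,
    fun n' W hW hxW hsub hnot => ⟨?_, ?_⟩⟩
  · exact div_le_div_of_nonneg_left hr.le (hA0 n) (le_ciSup hbdd n)
  · obtain rfl | ⟨V, d, rfl⟩ := W.eq_nil_or_concat'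
    · simp at hW
      omega
    obtain rfl : V.length + 1 = n := by simpa using hW
    rw [Nat.add_sub_cancel, List.take_left] at hnot
    rw [moranLen_concat]
    exact div_le_div_of_nonneg_right (lt_moranLen_of_not_subset_closedBall
      (moranI_concat_subset hA1 V d hxW) hnot).le (hA0 _).le
  · exact moranLen_le_of_moranI_subset_closedBall hA0 hsub
  · subst hW
    obtain ⟨d, hxd⟩ := exists_mem_moranI_concat hA2 hx hxW
    refine (moranLen_le_of_not_subset_moranI_concat hA2 hxd hsub
      (hnot _ (by simp) hxd)).trans ?_
    have hC := hA2 (W.length + 1)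
    have hCr := mul_pos (hA0 (W.length + 1)) hr
    exact div_le_div_of_nonneg_right (by linarith) (by linarith)
  · exact antitoneOn_two_mul_mul_div_sub_two hr.le hinf (hA2 _) (ciInf_le hlow _)
end
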